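/- Let Γ be a finite simplicial graph and 𝒢 = (G_u) a family of nontrivial finite groups indexed by the vertices of Γ. Then the automorphism group Aut(Γ𝒢) is SQ-universal if and only if the graph product Γ𝒢 is not virtually free abelian. -/

import Mathlib

/-- The set of commutation relators defining a graph product. -/
def graphProdRels {V : Type*} (Γ : SimpleGraph V) (G : V → Type*) [∀ w, Group (G w)] :
    Set (Monoid.CoprodI G) :=
  {x | ∃ (u v : V) (_ : Γ.Adj u v) (g : G u) (h : G v),
    x = Monoid.CoprodI.of g * Monoid.CoprodI.of h *
      (Monoid.CoprodI.of g)⁻¹ * (Monoid.CoprodI.of h)⁻¹}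

/-- The graph product of the family of groups `G` over the simplicial graph `Γ`. -/
def GraphProduct {V : Type*} (Γ : SimpleGraph V) (G : V → Type*) [∀ w, Group (G w)] :=
  Monoid.CoprodI G ⧸ Subgroup.normalClosure (graphProdRels Γ G)

instance {V : Type*} (Γ : SimpleGraph V) (G : V → Type*) [∀ w, Group (G w)] :
    Group (GraphProduct Γ G) :=
  inferInstanceAs (Group (Monoid.CoprodI G ⧸ Subgroup.normalClosure (graphProdRels Γ G)))

/-- The canonical map from a vertex group into the graph product. -/
def GraphProduct.of {V : Type*} (Γ : SimpleGraph V) (G : V → Type*) [∀ w, Group (G w)]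
    (u : V) : G u →* GraphProduct Γ G :=
  (QuotientGroup.mk' (Subgroup.normalClosure (graphProdRels Γ G))).comp Monoid.CoprodI.of

/-- The vertex subgroup of the graph product at the vertex `u`. -/
def vertexSubgroup {V : Type*} (Γ : SimpleGraph V) (G : V → Type*) [∀ w, Group (G w)]
    (u : V) : Subgroup (GraphProduct Γ G) :=
  (GraphProduct.of Γ G u).range

/-- An automorphism of the graph product is conjugating if it sends each vertex subgroup to
a conjugate of a vertex subgroup. -/
def IsConjugating {V : Type*} (Γ : SimpleGraph V) (G : V → Type*) [∀ w, Group (G w)]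
    (φ : MulAut (GraphProduct Γ G)) : Prop :=
  ∀ u : V, ∃ (v : V) (g : GraphProduct Γ G),
    Subgroup.map φ.toMonoidHom (vertexSubgroup Γ G u) =
      Subgroup.map (MulAut.conj g).toMonoidHom (vertexSubgroup Γ G v)

/-- An automorphism of the graph product is in `PConjAut` if it sends each vertex subgroup to
a conjugate of itself. -/
def IsPConjugating {V : Type*} (Γ : SimpleGraph V) (G : V → Type*) [∀ w, Group (G w)]
    (φ : MulAut (GraphProduct Γ G)) : Prop :=
  ∀ u : V, ∃ g : GraphProduct Γ G,
    Subgroup.map φ.toMonoidHom (vertexSubgroup Γ G u) =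
      Subgroup.map (MulAut.conj g).toMonoidHom (vertexSubgroup Γ G u)

/-- A vertex is universal if it is adjacent to every other vertex. -/
def IsUniversal {V : Type*} (Γ : SimpleGraph V) (u : V) : Prop :=
  ∀ v : V, v ≠ u → Γ.Adj u v

/-- Some vertex is non-adjacent to at least two other vertices. -/
def HasVertexWithTwoNonNeighbors {V : Type*} (Γ : SimpleGraph V) : Prop :=
  ∃ u v w : V, v ≠ w ∧ v ≠ u ∧ w ≠ u ∧ ¬Γ.Adj u v ∧ ¬Γ.Adj u w

/-- A group `G` is SQ-universal if every countable group embeds into a quotient of `G`. -/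
def SQUniversal (G : Type*) [Group G] : Prop :=
  ∀ (Q : Type) [Group Q] [Countable Q],
    ∃ (N : Subgroup G) (hN : N.Normal),
      haveI := hN
      ∃ f : Q →* G ⧸ N, Function.Injective f

/-- A quasimorphism on a group. -/
def IsQuasimorphism {H : Type*} [Group H] (f : H → ℝ) : Prop :=
  ∃ C : ℝ, 0 ≤ C ∧ ∀ g h : H, |f (g * h) - f g - f h| ≤ C

/-- A homogeneous map on a group. -/
def IsHomogeneous {H : Type*} [Group H] (f : H → ℝ) : Prop :=
  ∀ (g : H) (k : ℤ), f (g ^ k) = (k : ℝ) * f g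

/-- The space of homogeneous quasimorphisms of `H` is infinite-dimensional, expressed as: it is
not contained in the span of any finite set of functions. -/
def HasManyQuasimorphisms (H : Type*) [Group H] : Prop :=
  ¬ ∃ s : Finset (H → ℝ), ∀ f : H → ℝ, IsQuasimorphism f → IsHomogeneous f →
      f ∈ Submodule.span ℝ (s : Set (H → ℝ))

/-- A group virtually has many quasimorphisms if some finite-index subgroup has an
infinite-dimensional space of homogeneous quasimorphisms. -/
def VirtuallyManyQuasimorphisms (G : Type*) [Group G] : Prop :=
  ∃ H : Subgroup G, H.FiniteIndex ∧ HasManyQuasimorphisms H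

/-- A group is boundedly generated if it is the product of finitely many cyclic subgroups. -/
def BoundedlyGenerated (G : Type*) [Group G] : Prop :=
  ∃ l : List G, ∀ g : G, ∃ m : List ℤ, m.length = l.length ∧
    g = (List.zipWith (fun x (k : ℤ) => x ^ k) l m).prod

/-- A group is large if a finite-index subgroup surjects onto a nonabelian free group. -/
def IsLarge (G : Type*) [Group G] : Prop :=
  ∃ H : Subgroup G, H.FiniteIndex ∧ ∃ f : H →* FreeGroup (Fin 2), Function.Surjective f

/-- A group is virtually free abelian if it has a finite-index subgroup isomorphic to `ℤⁿ`. -/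
def VirtuallyFreeAbelian (G : Type*) [Group G] : Prop :=
  ∃ H : Subgroup G, H.FiniteIndex ∧ ∃ n : ℕ, Nonempty (H ≃* Multiplicative (Fin n → ℤ))

/-- The relators of a right-angled Coxeter group. -/
def racgRels {V : Type*} (Γ : SimpleGraph V) : Set (FreeGroup V) :=
  {w | (∃ v : V, w = FreeGroup.of v * FreeGroup.of v) ∨
    ∃ u v : V, Γ.Adj u v ∧ w = (FreeGroup.of u * FreeGroup.of v) ^ 2}

/-- The right-angled Coxeter group of a simplicial graph. -/
def RACG {V : Type*} (Γ : SimpleGraph V) := PresentedGroup (racgRels Γ)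

instance {V : Type*} (Γ : SimpleGraph V) : Group (RACG Γ) :=
  inferInstanceAs (Group (PresentedGroup (racgRels Γ)))

section FreeProduct

open Monoid Monoid.CoprodI

variable {ι : Type*} {M : ι → Type*} [∀ i, Group (M i)]

theorem neWord_prod_ne_one {i j : ι} (w : NeWord M i j) : w.prod ≠ 1 := by
  classical
  intro h
  have h1 : w.toWord = Word.empty := by
    apply Word.equiv.symm.injective
    simpa [Word.equiv, NeWord.prod] using h
  exact w.toList_ne_nil (congrArg Word.toList h1)

theorem neWord_toList_eq_of_prod_eq {i j k l : ι} (w : NeWord M i j) (w' : NeWord M k l)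
    (h : w.prod = w'.prod) : w.toList = w'.toList := by
  classical
  have h1 : w.toWord = w'.toWord := by
    apply Word.equiv.symm.injective
    simpa [Word.equiv, NeWord.prod] using h
  exact congrArg Word.toList h1

theorem neWord_fst_eq_of_prod_eq {i j k l : ι} (w : NeWord M i j) (w' : NeWord M k l)
    (h : w.prod = w'.prod) : i = k := by
  have h1 := w.toList_head?
  rw [neWord_toList_eq_of_prod_eq w w' h, w'.toList_head?] at h1
  exact (congrArg Sigma.fst (Option.some.inj h1)).symm

theorem exists_neWord_of_ne_one {x : CoprodI M} (hx : x ≠ 1) :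
    ∃ (i j : ι) (w : NeWord M i j), w.prod = x := by
  classical
  have h1 : Word.equiv x ≠ Word.empty := by
    intro h
    apply hx
    apply Word.equiv.injective
    rw [h]
    simp [Word.equiv]
  obtain ⟨i, j, w, hw⟩ := NeWord.of_word _ h1
  refine ⟨i, j, w, ?_⟩
  have : Word.equiv.symm (w.toWord) = x := by rw [hw, Equiv.symm_apply_apply]
  simpa [Word.equiv, NeWord.prod] using this

/-- Powers of a cyclically reduced word are reduced words. -/
theorem exists_neWord_pow {i j : ι} (w : NeWord M i j) (hij : j ≠ i) (n : ℕ) :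
    ∃ w' : NeWord M i j, w'.prod = w.prod ^ (n + 1) := by
  induction n with
  | zero => exact ⟨w, by simp⟩
  | succ n ih =>
    obtain ⟨w', hw'⟩ := ih
    exact ⟨w'.append hij w, by rw [NeWord.append_prod, hw', ← pow_succ]⟩

theorem not_isOfFinOrder_neWord {i j : ι} (w : NeWord M i j) (hij : j ≠ i) :
    ¬IsOfFinOrder w.prod := by
  rw [isOfFinOrder_iff_pow_eq_one]
  rintro ⟨n, hn, h⟩
  obtain ⟨m, rfl⟩ : ∃ m, n = m + 1 := ⟨n - 1, by omega⟩
  obtain ⟨w', hw'⟩ := exists_neWord_pow w hij m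
  exact neWord_prod_ne_one w' (hw'.trans h)

/-- Removing the last syllable of a reduced word. -/
theorem neWord_strip_last {i j : ι} (w : NeWord M i j) :
    ((j = i ∧ w.toList.length = 1) ∧ ∃ m : M j, w.prod = of m) ∨
      ∃ (k : ι) (_ : k ≠ j) (w' : NeWord M i k) (m : M j),
        w.prod = w'.prod * of m ∧ w.toList.length = w'.toList.length + 1 := by
  induction w with
  | singleton x hx => exact Or.inl ⟨⟨rfl, rfl⟩, x, by simp⟩
  | append w₁ hne w₂ ih₁ ih₂ =>
    right
    rcases ih₂ with ⟨⟨rfl, hl⟩, m, hm⟩ | ⟨k, hk, w', m, hm, hl⟩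
    · exact ⟨_, hne, w₁, m, by simp [hm], by simp [NeWord.toList, hl]⟩
    · exact ⟨k, hk, w₁.append hne w', m, by simp [hm, mul_assoc], by
        simp [NeWord.toList, hl, add_assoc]⟩

/-- Removing the first syllable of a reduced word. -/
theorem neWord_strip_first {i j : ι} (w : NeWord M i j) :
    ((j = i ∧ w.toList.length = 1) ∧ ∃ m : M i, w.prod = of m) ∨
      ∃ (k : ι) (_ : k ≠ i) (w' : NeWord M k j) (m : M i),
        w.prod = of m * w'.prod ∧ w.toList.length = w'.toList.length + 1 := by
  induction w with
  | singleton x hx => exact Or.inl ⟨⟨rfl, rfl⟩, x, by simp⟩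
  | append w₁ hne w₂ ih₁ ih₂ =>
    right
    rcases ih₁ with ⟨⟨rfl, hl⟩, m, hm⟩ | ⟨k, hk, w', m, hm, hl⟩
    · exact ⟨_, hne.symm, w₂, m, by simp [hm], by simp [NeWord.toList, hl, add_comm]⟩
    · exact ⟨k, hk, w'.append hne w₂, m, by simp [hm, mul_assoc], by
        simp [NeWord.toList, hl]; omega⟩

theorem exists_strip_left (x : CoprodI M) (i : ι) :
    ∃ (m : M i) (y : CoprodI M), x = of m * y ∧
      (y = 1 ∨ ∃ (k l : ι) (w : NeWord M k l), k ≠ i ∧ w.prod = y) := by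
  by_cases hx : x = 1
  · exact ⟨1, 1, by simp [hx], Or.inl rfl⟩
  obtain ⟨k, l, w, rfl⟩ := exists_neWord_of_ne_one hx
  by_cases hk : k = i
  · subst hk
    rcases neWord_strip_first w with ⟨-, m, hm⟩ | ⟨k', hk', w', m, hm, -⟩
    · exact ⟨m, 1, by simp [hm], Or.inl rfl⟩
    · exact ⟨m, w'.prod, hm, Or.inr ⟨k', l, w', hk', rfl⟩⟩
  · exact ⟨1, w.prod, by simp, Or.inr ⟨k, l, w, hk, rfl⟩⟩

theorem exists_strip_both (x : CoprodI M) (i j : ι) :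
    (∃ (m : M i) (m' : M j), x = of m * of m') ∨
      ∃ (m : M i) (m' : M j) (k l : ι) (w : NeWord M k l), k ≠ i ∧ l ≠ j ∧
        x = of m * w.prod * of m' := by
  obtain ⟨m, y, rfl, rfl | ⟨k, l, w, hk, rfl⟩⟩ := exists_strip_left x i
  · exact Or.inl ⟨m, 1, by simp⟩
  · by_cases hl : l = j
    · subst hl
      rcases neWord_strip_last w with ⟨-, m', hm⟩ | ⟨l', hl', w', m', hm, -⟩
      · exact Or.inl ⟨m, m', by rw [hm]⟩
      · exact Or.inr ⟨m, m', k, l', w', hk, hl', by rw [hm, mul_assoc]⟩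
    · exact Or.inr ⟨m, 1, k, l, w, hk, hl, by simp⟩

/-- Elements of finite order in a free product are conjugate into a factor. -/
theorem exists_conj_of_isOfFinOrder [Nonempty ι] {x : CoprodI M} (hx : IsOfFinOrder x) :
    ∃ (g : CoprodI M) (i : ι) (m : M i), x = g * of m * g⁻¹ := by
  by_cases h1 : x = 1
  · exact ⟨1, Classical.arbitrary ι, 1, by simp [h1]⟩
  obtain ⟨i, j, w, rfl⟩ := exists_neWord_of_ne_one h1
  clear h1
  induction h : w.toList.length using Nat.strong_induction_on generalizing i j w with
  | _ n ih =>
  by_cases hij : j = i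
  · subst hij
    rcases neWord_strip_first w with ⟨-, m, hm⟩ | ⟨k, hk, w', m, hm, hl⟩
    · exact ⟨1, j, m, by simp [hm]⟩
    · rcases neWord_strip_last w' with ⟨⟨h', -⟩, -⟩ | ⟨l, hl', w'', m', hm', hlen⟩
      · exact absurd h'.symm hk
      · have hconj : (of m)⁻¹ * w.prod * of m = w''.prod * of (m' * m) := by
          rw [hm, hm']; simp [mul_assoc]
        have hfin : IsOfFinOrder (w''.prod * of (m' * m)) := by
          rw [← hconj]
          have := (MulAut.conj (of m : CoprodI M)⁻¹).toMonoidHom.isOfFinOrder hx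
          simpa using this
        by_cases hmm : m' * m = 1
        · rw [hmm, map_one, mul_one] at hfin hconj
          obtain ⟨g, i, a, ha⟩ := ih _ (by omega) _ _ w'' hfin rfl
          refine ⟨of m * g, i, a, ?_⟩
          rw [ha] at hconj
          calc w.prod = of m * ((of m)⁻¹ * w.prod * of m) * (of m)⁻¹ := by group
            _ = _ := by rw [hconj]; group
        · exfalso
          have := not_isOfFinOrder_neWord (w''.append hl' (NeWord.singleton _ hmm)) hk.symm
          apply this
          simpa using hfin
  · exact absurd hx (not_isOfFinOrder_neWord w hij)

/-- The canonical map from a free product to the direct product. -/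
noncomputable def coprodToPi (M : ι → Type*) [∀ i, Group (M i)] :
    CoprodI M →* ∀ i, M i :=
  letI := Classical.decEq ι
  CoprodI.lift fun i => MonoidHom.mulSingle M i

theorem coprodToPi_of [DecidableEq ι] (i : ι) (m : M i) :
    coprodToPi M (of m) = Pi.mulSingle i m := by
  simp only [coprodToPi, CoprodI.lift_of, MonoidHom.mulSingle_apply]
  congr!

theorem coprodToPi_of_same (i : ι) (m : M i) : coprodToPi M (of m) i = m := by
  classical
  simp [coprodToPi_of]

theorem coprodToPi_of_ne {i j : ι} (h : j ≠ i) (m : M i) : coprodToPi M (of m) j = 1 := by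
  classical
  simp [coprodToPi_of, h]

theorem eq_one_of_coprodToPi_eq_one {x : CoprodI M} (hx : IsOfFinOrder x)
    (h : coprodToPi M x = 1) : x = 1 := by
  rcases isEmpty_or_nonempty ι with hι | hι
  · by_contra h1
    obtain ⟨i, -⟩ := exists_neWord_of_ne_one h1
    exact isEmptyElim i
  obtain ⟨g, i, m, rfl⟩ := exists_conj_of_isOfFinOrder hx
  have h2 := congrFun h i
  simp only [map_mul, Pi.mul_apply, coprodToPi_of_same, map_inv, Pi.inv_apply, Pi.one_apply] at h2
  have : m = 1 := by simpa using h2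
  simp [this]

theorem mem_range_of_isOfFinOrder_mul {i : ι} {a b : M i} (ha : a ≠ 1) (hb : b ≠ 1)
    (h : CoprodI M) (hfin : IsOfFinOrder (of a * (h * of b * h⁻¹))) :
    h * of b * h⁻¹ ∈ (of : M i →* CoprodI M).range := by
  rcases exists_strip_both h i i with ⟨m, m', rfl⟩ | ⟨m, m', k, l, w, hk, hl, rfl⟩
  · exact ⟨m * m' * b * m'⁻¹ * m⁻¹, by simp [mul_assoc]⟩
  · exfalso
    have h1 : m⁻¹ * a * m ≠ 1 := by
      intro h; apply ha
      calc a = m * (m⁻¹ * a * m) * m⁻¹ := by group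
        _ = 1 := by rw [h]; group
    have h2 : m' * b * m'⁻¹ ≠ 1 := by simpa using hb
    have := not_isOfFinOrder_neWord
      ((NeWord.singleton _ h1).append hk.symm
        ((w.append hl (NeWord.singleton _ h2)).append hl.symm w.inv)) hk
    apply this
    have h3 := (MulAut.conj (of m : CoprodI M)⁻¹).toMonoidHom.isOfFinOrder hfin
    convert h3 using 1
    simp [mul_assoc]

/-- A homomorphism from a finite factor that induces the canonical map to the direct product
is conjugate to the canonical embedding. -/
theorem exists_conj_of_coprodToPi_comp {i : ι} [Finite (M i)] (σ : M i →* CoprodI M)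
    (hσ : ∀ m, coprodToPi M (σ m) = coprodToPi M (of m)) :
    ∃ g : CoprodI M, ∀ m, σ m = g * of m * g⁻¹ := by
  have : Nonempty ι := ⟨i⟩
  have key : ∀ m : M i, ∃ (g : CoprodI M) (m' : M i), σ m = g * of m' * g⁻¹ := by
    intro m
    by_cases hm : m = 1
    · exact ⟨1, 1, by simp [hm]⟩
    obtain ⟨g, j, m', h⟩ := exists_conj_of_isOfFinOrder
      (σ.isOfFinOrder (isOfFinOrder_of_finite m))
    have hij : i = j := by
      by_contra hij
      have h2 := congrFun (hσ m) i
      rw [h] at h2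
      simp only [map_mul, Pi.mul_apply, coprodToPi_of_same, map_inv, Pi.inv_apply,
        coprodToPi_of_ne hij] at h2
      apply hm
      simpa using h2.symm
    subst hij
    exact ⟨g, m', h⟩
  by_cases htriv : ∀ m : M i, m = 1
  · exact ⟨1, fun m => by simp [htriv m]⟩
  push Not at htriv
  obtain ⟨m₀, hm₀⟩ := htriv
  have hinj : ∀ m, σ m = 1 → m = 1 := by
    intro m hm
    have := congrFun (hσ m) i
    rw [hm, coprodToPi_of_same] at this
    simpa using this.symm
  obtain ⟨g, a, hg⟩ := key m₀
  have ha : a ≠ 1 := by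
    rintro rfl
    exact hm₀ (hinj _ (by simpa using hg))
  have hmem : ∀ m, ∃ c : M i, g⁻¹ * σ m * g = of c := by
    intro m
    by_cases hm : m = 1
    · exact ⟨1, by simp [hm]⟩
    obtain ⟨h, b, hb⟩ := key m
    have hb1 : b ≠ 1 := by
      rintro rfl
      exact hm (hinj _ (by simpa using hb))
    have hfin : IsOfFinOrder (of a * ((g⁻¹ * h) * of b * (g⁻¹ * h)⁻¹)) := by
      have h3 := (MulAut.conj g⁻¹).toMonoidHom.isOfFinOrder
        (σ.isOfFinOrder (isOfFinOrder_of_finite (m₀ * m)))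
      convert h3 using 1
      simp [hg, hb, mul_assoc]
    obtain ⟨c, hc⟩ := mem_range_of_isOfFinOrder_mul ha hb1 _ hfin
    exact ⟨c, by rw [hc, hb]; group⟩
  refine ⟨g * of (coprodToPi M g i)⁻¹, fun m => ?_⟩
  obtain ⟨c, hc⟩ := hmem m
  have h4 : c = (coprodToPi M g i)⁻¹ * m * coprodToPi M g i := by
    rw [← coprodToPi_of_same i c, ← hc]
    simp [hσ, coprodToPi_of_same]
  calc σ m = g * (g⁻¹ * σ m * g) * g⁻¹ := by group
    _ = _ := by rw [hc, h4]; simp [mul_assoc]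

end FreeProduct

section FreeProductOfTwo

open Monoid Monoid.CoprodI

variable {M : Bool → Type*} [∀ i, Group (M i)]

theorem neWord_length_pos {ι : Type*} {M : ι → Type*} [∀ i, Group (M i)] {i j : ι}
    (w : NeWord M i j) : 0 < w.toList.length :=
  List.length_pos_iff.mpr w.toList_ne_nil

theorem exists_eq_of_mul_of_of_surjective [Nontrivial (M true)] (k : CoprodI M)
    (ψ : CoprodI M →* CoprodI M) (h₀ : ∀ a : M false, ψ (of a) = of a)
    (h₁ : ∀ b : M true, ψ (of b) = k * of b * k⁻¹) (hψ : Function.Surjective ψ) :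
    ∃ (a : M false) (b : M true), k = of a * of b := by
  rcases exists_strip_both k false true with h | ⟨a, b, i, j, w, hi, hj, rfl⟩
  · exact h
  exfalso
  obtain rfl : i = true := by simpa using hi
  obtain rfl : j = false := by simpa using hj
  have key : ∀ {i j : Bool} (u : NeWord M i j), ∃ u' : NeWord M i j,
      u'.prod = (of a)⁻¹ * ψ u.prod * of a ∧ (i = true → 2 ≤ u'.toList.length) := by
    intro i j u
    induction u with
    | @singleton i x hx =>
      cases i with
      | false =>
        have h1 : a⁻¹ * x * a ≠ 1 := by
          intro h; apply hx
          calc x = a * (a⁻¹ * x * a) * a⁻¹ := by group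
            _ = 1 := by rw [h]; group
        exact ⟨NeWord.singleton _ h1, by simp [h₀], by simp⟩
      | true =>
        have h1 : b * x * b⁻¹ ≠ 1 := by simpa using hx
        refine ⟨w.append hj ((NeWord.singleton _ h1).append hj.symm w.inv), ?_, ?_⟩
        · simp [h₁, mul_assoc]
        · intro _
          have := neWord_length_pos w
          simp only [NeWord.toList, List.length_append, List.length_singleton]
          omega
    | append w₁ hne w₂ ih₁ ih₂ =>
      obtain ⟨u₁, h1, l1⟩ := ih₁
      obtain ⟨u₂, h2, -⟩ := ih₂
      refine ⟨u₁.append hne u₂, by simp [h1, h2, mul_assoc], fun hi => ?_⟩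
      have := l1 hi
      simp only [NeWord.toList, List.length_append]
      omega
  obtain ⟨y, hy⟩ := exists_ne (1 : M true)
  obtain ⟨x, hx⟩ := hψ (of a * of y * (of a)⁻¹)
  have hx1 : x ≠ 1 := by
    rintro rfl
    apply hy
    apply of_injective (M := M) true
    have : (1 : CoprodI M) = of a * of y * (of a)⁻¹ := by rw [← hx, map_one]
    rw [map_one]
    calc of y = (of a)⁻¹ * (of a * of y * (of a)⁻¹) * of a := by group
      _ = 1 := by rw [← this]; group
  obtain ⟨i, j, u, rfl⟩ := exists_neWord_of_ne_one hx1
  obtain ⟨u', hu', hl⟩ := key u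
  have h3 : u'.prod = (NeWord.singleton y hy).prod := by
    rw [hu', hx, NeWord.prod_singleton]; group
  have h4 := hl (neWord_fst_eq_of_prod_eq _ _ h3)
  rw [neWord_toList_eq_of_prod_eq _ _ h3] at h4
  simp at h4

theorem eq_one_of_forall_commute_of [∀ i, Nontrivial (M i)] (p : CoprodI M)
    (hp : ∀ (i : Bool) (m : M i), p * of m = of m * p) : p = 1 := by
  have key : ∀ i : Bool, ∃ m : M i, p = of m := by
    intro i
    rcases exists_strip_both p i i with ⟨m, m', h⟩ | ⟨m, m', k, l, w, hk, hl, h⟩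
    · exact ⟨m * m', by rw [h, map_mul]⟩
    · exfalso
      obtain ⟨x, hx⟩ := exists_ne (1 : M i)
      have h1 : w.prod * of (m' * m * x) = of x * w.prod * of (m' * m) := by
        have h2 : p = w.prod * of (m' * m) := by
          have := hp i m
          rw [h] at this ⊢
          rw [map_mul]
          calc of m * w.prod * of m' = (of m)⁻¹ * (of m * (of m * w.prod * of m')) := by group
            _ = _ := by rw [← this]; group
        have := hp i x
        rw [h2] at this
        rw [map_mul _ (m' * m), ← mul_assoc, this, mul_assoc]
      have h3 : ∃ (l' : Bool) (u : NeWord M k l'), u.prod = w.prod * of (m' * m * x) := by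
        by_cases h0 : m' * m * x = 1
        · exact ⟨l, w, by simp [h0]⟩
        · exact ⟨i, w.append hl (NeWord.singleton _ h0), by simp⟩
      have h4 : ∃ (l' : Bool) (u : NeWord M i l'), u.prod = of x * w.prod * of (m' * m) := by
        by_cases h0 : m' * m = 1
        · exact ⟨l, (NeWord.singleton _ hx).append hk.symm w, by simp [h0]⟩
        · exact ⟨i, ((NeWord.singleton _ hx).append hk.symm w).append hl
            (NeWord.singleton _ h0), by simp⟩
      obtain ⟨l₁, u₁, hu₁⟩ := h3
      obtain ⟨l₂, u₂, hu₂⟩ := h4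
      exact hk (neWord_fst_eq_of_prod_eq u₁ u₂ (by rw [hu₁, hu₂, h1]))
  obtain ⟨a, ha⟩ := key false
  obtain ⟨b, hb⟩ := key true
  have h1 : a = 1 := by
    rw [← coprodToPi_of_same false a, ← ha, hb, coprodToPi_of_ne (by simp)]
  rw [ha, h1, map_one]

end FreeProductOfTwo

/-- A group virtually maps onto a finite-index subgroup of a free group of rank two. -/
def IsVirtuallyLarge (G : Type*) [Group G] : Prop :=
  ∃ H : Subgroup G, H.FiniteIndex ∧ ∃ f : H →* FreeGroup (Fin 2), f.range.FiniteIndex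

theorem finiteIndex_map_subgroupOf_range {G K : Type*} [Group G] [Group K] (f : G →* K)
    (H : Subgroup G) [H.FiniteIndex] : ((H.map f).subgroupOf f.range).FiniteIndex := by
  have h : (H.map f.rangeRestrict) = (H.map f).subgroupOf f.range := by
    ext ⟨x, hx⟩
    simp [Subgroup.mem_subgroupOf, Subtype.ext_iff]
  rw [← h, Subgroup.finiteIndex_iff]
  exact fun h0 => Subgroup.FiniteIndex.index_ne_zero (H := H)
    (Nat.eq_zero_of_zero_dvd (h0 ▸ H.index_map_dvd f.rangeRestrict_surjective))

theorem finiteIndex_map {G K : Type*} [Group G] [Group K] (f : G →* K)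
    (hf : f.range.FiniteIndex) (H : Subgroup G) [H.FiniteIndex] : (H.map f).FiniteIndex := by
  have h1 := finiteIndex_map_subgroupOf_range f H
  rw [Subgroup.finiteIndex_iff] at *
  have h2 := Subgroup.relIndex_mul_index (Subgroup.map_le_range f H)
  rw [← h2]
  exact mul_ne_zero h1 hf

theorem finiteIndex_map_subtype {G : Type*} [Group G] (H : Subgroup G) [H.FiniteIndex]
    (K : Subgroup H) [K.FiniteIndex] : (K.map H.subtype).FiniteIndex :=
  finiteIndex_map H.subtype (by rwa [Subgroup.range_subtype]) K

theorem IsVirtuallyLarge.of_hom {G P : Type*} [Group G] [Group P] (hP : IsVirtuallyLarge P)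
    (H : Subgroup G) (hH : H.FiniteIndex) (f : H →* P) (hf : f.range.FiniteIndex) :
    IsVirtuallyLarge G := by
  obtain ⟨K, hK, k, hk⟩ := hP
  let L : Subgroup H := K.comap f
  have : L.FiniteIndex := by
    rw [Subgroup.finiteIndex_iff]
    have := Subgroup.index_comap K f
    rw [this]
    exact Subgroup.FiniteIndex.index_ne_zero (H := K.subgroupOf f.range)
  let g : L →* K := (f.comp L.subtype).codRestrict K (fun x => x.2)
  have hg : g.range.FiniteIndex := by
    have : g.range = f.range.subgroupOf K := by
      ext ⟨x, hx⟩
      simp only [MonoidHom.mem_range, Subgroup.mem_subgroupOf]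
      constructor
      · rintro ⟨y, hy⟩
        exact ⟨y.1, congrArg Subtype.val hy⟩
      · rintro ⟨y, hy⟩
        exact ⟨⟨y, by change f y ∈ K; rw [hy]; exact hx⟩, Subtype.ext hy⟩
    rw [this]
    infer_instance
  let e : L ≃* L.map H.subtype := L.equivMapOfInjective H.subtype H.subtype_injective
  refine ⟨L.map H.subtype, finiteIndex_map_subtype H L, (k.comp g).comp e.symm.toMonoidHom, ?_⟩
  have : ((k.comp g).comp e.symm.toMonoidHom).range = g.range.map k := by
    rw [MonoidHom.range_comp, MonoidHom.range_eq_top.mpr e.symm.surjective, ← MonoidHom.range_eq_map,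
      MonoidHom.range_comp]
  rw [this]
  exact finiteIndex_map k hk g.range

theorem IsVirtuallyLarge.of_surjective {G P : Type*} [Group G] [Group P]
    (hP : IsVirtuallyLarge P) (f : G →* P) (hf : Function.Surjective f) :
    IsVirtuallyLarge G := by
  refine hP.of_hom ⊤ inferInstance (f.comp (⊤ : Subgroup G).subtype) ?_
  have : (f.comp (⊤ : Subgroup G).subtype).range = ⊤ := by
    rw [MonoidHom.range_eq_top]
    intro x
    obtain ⟨y, rfl⟩ := hf x
    exact ⟨⟨y, trivial⟩, rfl⟩
  rw [this]
  infer_instance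

/-- A free product of two finite groups, not both of order two, is virtually large. -/
theorem isVirtuallyLarge_coprodI {M : Bool → Type*} [∀ i, Group (M i)] [∀ i, Finite (M i)]
    {a : M false} (ha : a ≠ 1) {b c : M true} (hb : b ≠ 1) (hc : c ≠ 1) (hbc : b ≠ c) :
    IsVirtuallyLarge (Monoid.CoprodI M) := by
  classical
  let T := ∀ i, M i
  let x : T := Pi.mulSingle false a
  let y : T := Pi.mulSingle true b
  let z : T := Pi.mulSingle true c
  let F := FreeGroup (Fin 2)
  let f : T → F := fun t =>
    if t = y⁻¹ * x⁻¹ then (FreeGroup.of 0)⁻¹ else if t = z⁻¹ * x⁻¹ then (FreeGroup.of 1)⁻¹ else 1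
  let v : F ≀ᵣ T := ⟨f, 1⟩
  let θ : Monoid.CoprodI M →* F ≀ᵣ T := Monoid.CoprodI.lift fun i =>
    match i with
    | false => RegularWreathProduct.inl.comp (MonoidHom.mulSingle M false)
    | true => (MulAut.conj v).toMonoidHom.comp
        (RegularWreathProduct.inl.comp (MonoidHom.mulSingle M true))
  have hθ : ∀ p, (θ p).right = coprodToPi M p := by
    intro p
    have : RegularWreathProduct.rightHom.comp θ = coprodToPi M := by
      apply Monoid.CoprodI.ext_hom
      intro i
      ext1 m
      cases i <;> simp [θ, v] <;> rw [coprodToPi_of] <;> rfl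
    exact DFunLike.congr_fun this p
  let K := (coprodToPi M).ker
  let g : K →* F := MonoidHom.mk' (fun k => (θ k).left 1) (by
    rintro ⟨k, hk⟩ ⟨l, hl⟩
    have : (θ k).right = 1 := by rw [hθ]; exact hk
    simp [this])
  refine ⟨K, inferInstance, g, ?_⟩
  have hval : ∀ d : M true, ∃ k : K, g k = f (x⁻¹) * (f ((Pi.mulSingle true d : T)⁻¹ * x⁻¹))⁻¹ *
      (f ((Pi.mulSingle true d : T)⁻¹)) * (f 1)⁻¹ := by
    intro d
    let k : Monoid.CoprodI M := Monoid.CoprodI.of a * Monoid.CoprodI.of d *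
      (Monoid.CoprodI.of a)⁻¹ * (Monoid.CoprodI.of d)⁻¹
    have hcomm : (Pi.mulSingle true d : T) * x = x * Pi.mulSingle true d :=
      Pi.mulSingle_commute (f := M) (by simp) d a
    have hk : k ∈ K := by
      change coprodToPi M k = 1
      simp only [k, map_mul, map_inv, coprodToPi_of]
      change x * Pi.mulSingle true d * x⁻¹ * (Pi.mulSingle true d)⁻¹ = 1
      rw [← hcomm, mul_inv_cancel_right, mul_inv_cancel]
    refine ⟨⟨k, hk⟩, ?_⟩
    change (θ k).left 1 = _
    have ha : θ (Monoid.CoprodI.of a) = RegularWreathProduct.inl x := by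
      simp only [θ, Monoid.CoprodI.lift_of]; rfl
    have hd : θ (Monoid.CoprodI.of d) =
        v * RegularWreathProduct.inl (Pi.mulSingle true d : T) * v⁻¹ := by
      simp only [θ, Monoid.CoprodI.lift_of]; rfl
    have h6 : x * ((Pi.mulSingle true d : T) * x⁻¹) = Pi.mulSingle true d := by
      rw [← mul_assoc, ← hcomm, mul_inv_cancel_right]
    simp only [k, map_mul, map_inv, ha, hd]
    simp only [RegularWreathProduct.mul_left, RegularWreathProduct.mul_right,
      RegularWreathProduct.inv_left, RegularWreathProduct.inv_right,
      RegularWreathProduct.left_inl, RegularWreathProduct.right_inl]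
    simp [v, mul_assoc, h6]
    exact (mul_inv_rev _ _).trans (by rw [inv_inv])
  have hxf : x false ≠ 1 := by simpa [x] using ha
  have hinv : ∀ d : M true, (Pi.mulSingle true d : T)⁻¹ false = 1 := by simp
  have hx0 : ∀ d e : M true, (Pi.mulSingle true d : T)⁻¹ ≠ (Pi.mulSingle true e : T)⁻¹ * x⁻¹ := by
    intro d e h
    have := congrFun h false
    rw [Pi.mul_apply, hinv, hinv, one_mul, Pi.inv_apply] at this
    exact hxf (inv_eq_one.mp this.symm)
  have hx1 : ∀ d : M true, d ≠ 1 → x⁻¹ ≠ (Pi.mulSingle true d : T)⁻¹ * x⁻¹ := by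
    intro d hd h
    rw [eq_comm, mul_eq_right, inv_eq_one] at h
    exact hd (Pi.mulSingle_eq_one_iff.mp h)
  have h1 : ∀ d : M true, f (Pi.mulSingle true d : T)⁻¹ = 1 := fun d => by
    simp only [f, y, z, if_neg (hx0 _ _)]
  have h2 : f 1 = 1 := by simpa using h1 1
  have h3 : f x⁻¹ = 1 := by simp only [f, y, z, if_neg (hx1 _ hb), if_neg (hx1 _ hc)]
  have h4 : f (y⁻¹ * x⁻¹) = (FreeGroup.of 0)⁻¹ := by simp only [f, if_true]
  have h5 : f (z⁻¹ * x⁻¹) = (FreeGroup.of 1)⁻¹ := by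
    have : z⁻¹ * x⁻¹ ≠ y⁻¹ * x⁻¹ := by
      rw [Ne, mul_left_inj, inv_inj]
      exact fun h => hbc (Pi.mulSingle_injective true h.symm)
    simp only [f, if_neg this, if_true]
  have htop : g.range = ⊤ := by
    rw [eq_top_iff, ← FreeGroup.closure_range_of, Subgroup.closure_le]
    rintro _ ⟨i, rfl⟩
    fin_cases i
    · obtain ⟨k, hk⟩ := hval b
      refine ⟨k, ?_⟩
      rw [hk, h1, h2, h3]
      change 1 * (f (y⁻¹ * x⁻¹))⁻¹ * 1 * 1⁻¹ = _
      rw [h4, inv_inv, inv_one, mul_one, mul_one, one_mul]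
      rfl
    · obtain ⟨k, hk⟩ := hval c
      refine ⟨k, ?_⟩
      rw [hk, h1, h2, h3]
      change 1 * (f (z⁻¹ * x⁻¹))⁻¹ * 1 * 1⁻¹ = _
      rw [h5, inv_inv, inv_one, mul_one, mul_one, one_mul]
      rfl
  rw [htop]
  infer_instance

section InfiniteSymmetric

open Equiv

theorem exists_injective_seq_of_infinite_support {g : Perm ℕ} (hg : {x | g x ≠ x}.Infinite) :
    ∃ y : ℕ ↪ ℕ, ∀ m n, g (y m) ≠ y n := by
  obtain ⟨y, hy, hr⟩ := exists_seq_of_forall_finset_exists (fun x => g x ≠ x)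
    (fun x z => x ≠ z ∧ g x ≠ z ∧ g z ≠ x) (by
      intro s _
      obtain ⟨z, hz, hz'⟩ := hg.exists_notMem_finset (s ∪ s.image g ∪ s.image g.symm)
      refine ⟨z, hz, fun x hx => ⟨?_, ?_, ?_⟩⟩
      · rintro rfl
        exact hz' (by simp [hx])
      · rintro rfl
        exact hz' (by simp [hx])
      · intro h
        refine hz' ?_
        simp only [Finset.mem_union, Finset.mem_image]
        exact Or.inr ⟨x, hx, by rw [← h]; simp⟩)
  have hinj : Function.Injective y := by
    intro m n h
    rcases lt_trichotomy m n with h1 | h1 | h1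
    · exact absurd h (hr m n h1).1
    · exact h1
    · exact absurd h.symm (hr n m h1).1
  refine ⟨⟨y, hinj⟩, fun m n => ?_⟩
  change g (y m) ≠ y n
  rcases lt_trichotomy m n with h1 | rfl | h1
  · exact (hr m n h1).2.1
  · exact hy m
  · exact (hr n m h1).2.2

theorem commutator_mem_of_disjoint_conj {G : Type*} [Group G] {N : Subgroup G} [N.Normal]
    {g h k : G} (hg : g ∈ N) (h1 : Commute (g * h * g⁻¹) k) : h⁻¹ * k * h * k⁻¹ ∈ N := by
  have h2 : g * h * g⁻¹ * h⁻¹ ∈ N := by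
    have := N.mul_mem hg (‹N.Normal›.conj_mem _ (N.inv_mem hg) h)
    simpa [mul_assoc] using this
  have h3 : (g * h * g⁻¹ * h⁻¹) * (k * (g * h * g⁻¹ * h⁻¹)⁻¹ * k⁻¹) ∈ N :=
    N.mul_mem h2 (‹N.Normal›.conj_mem _ (N.inv_mem h2) k)
  have h4 : (g * h * g⁻¹ * h⁻¹) * (k * (g * h * g⁻¹ * h⁻¹)⁻¹ * k⁻¹) =
      (g * h * g⁻¹) * (h⁻¹ * k * h * k⁻¹) * (g * h * g⁻¹)⁻¹ := by
    rw [mul_inv_rev, inv_inv]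
    have : (g * h * g⁻¹)⁻¹ * k⁻¹ = k⁻¹ * (g * h * g⁻¹)⁻¹ := h1.inv_inv.eq
    simp only [mul_assoc] at this ⊢
    rw [this]
  rw [h4] at h3
  have := ‹N.Normal›.conj_mem _ h3 (g * h * g⁻¹)⁻¹
  simpa [mul_assoc] using this

/-- The permutation of `ℤ × ℕ` acting as `τ` on every fibre over `n ≥ k`. -/
def permCopies (τ : Perm ℕ) (k : ℤ) : Perm (ℤ × ℕ) where
  toFun p := (p.1, if k ≤ p.1 then τ p.2 else p.2)
  invFun p := (p.1, if k ≤ p.1 then τ.symm p.2 else p.2)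
  left_inv p := by by_cases h : k ≤ p.1 <;> simp [h]
  right_inv p := by by_cases h : k ≤ p.1 <;> simp [h]

theorem exists_viaEmbedding_mem {N : Subgroup (Perm ℕ)} [N.Normal] {g : Perm ℕ} (hgN : g ∈ N)
    (hg : {x | g x ≠ x}.Infinite) :
    ∃ κ : ℕ ↪ ℕ, (Set.range κ)ᶜ.Infinite ∧ ∀ τ : Perm ℕ, τ.viaEmbedding κ ∈ N := by
  obtain ⟨y, hy⟩ := exists_injective_seq_of_infinite_support hg
  let e : ℤ × ℕ ↪ ℕ := (Denumerable.eqv (ℤ × ℕ)).toEmbedding.trans y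
  have hdisj : ∀ p q, g (e p) ≠ e q := fun p q => hy _ _
  let κ : ℕ ↪ ℕ := ⟨fun j => e (0, j), fun i j h => by simpa using e.injective h⟩
  refine ⟨κ, ?_, fun τ => ?_⟩
  · have : Set.range (fun j : ℕ => e (1, j)) ⊆ (Set.range κ)ᶜ := by
      rintro _ ⟨j, rfl⟩ ⟨i, hi⟩
      have := e.injective hi
      simp at this
    refine Set.Infinite.mono this (Set.infinite_range_of_injective fun i j h => ?_)
    simpa using e.injective h
  · let s : Perm (ℤ × ℕ) := (Equiv.addRight (1 : ℤ)).prodCongr (Equiv.refl ℕ)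
    let h : Perm (ℤ × ℕ) := permCopies τ⁻¹ 0
    have hcomm : ∀ a b : Perm (ℤ × ℕ),
        Commute (g * a.viaEmbedding e * g⁻¹) (b.viaEmbedding e) := by
      intro a b
      refine Equiv.Perm.Disjoint.commute fun x => ?_
      by_cases hx : x ∈ Set.range e
      · left
        have : g⁻¹ x ∉ Set.range e := by
          rintro ⟨p, hp⟩
          obtain ⟨q, rfl⟩ := hx
          exact hdisj p q (by rw [hp]; simp)
        rw [Perm.mul_apply, Perm.mul_apply, Perm.viaEmbedding_apply_of_notMem _ _ _ this]
        simp
      · exact Or.inr (Perm.viaEmbedding_apply_of_notMem _ _ _ hx)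
    have := commutator_mem_of_disjoint_conj (N := N) hgN (hcomm h s)
    have h1 : (h.viaEmbedding e)⁻¹ * s.viaEmbedding e * h.viaEmbedding e * (s.viaEmbedding e)⁻¹ =
        (h⁻¹ * s * h * s⁻¹).viaEmbedding e := by
      simp only [← Perm.viaEmbeddingHom_apply, map_mul, map_inv]
    rw [h1] at this
    convert this using 1
    refine Equiv.ext fun x => ?_
    by_cases hx : x ∈ Set.range e
    · obtain ⟨⟨n, j⟩, rfl⟩ := hx
      rw [Perm.viaEmbedding_apply]
      by_cases hn : n = 0
      · subst hn
        change τ.viaEmbedding κ (κ j) = _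
        rw [Perm.viaEmbedding_apply]
        rfl
      · rw [Perm.viaEmbedding_apply_of_notMem]
        · congr 1
          have h2 : (h⁻¹ * s * h * s⁻¹) (n, j) = h⁻¹ (s (h (n - 1, j))) := rfl
          rw [h2, Perm.eq_inv_iff_eq]
          by_cases hn' : 0 ≤ n
          · have : 1 ≤ n := by omega
            simp [h, s, permCopies, hn', this]
          · have : ¬ 1 ≤ n := by omega
            simp [h, s, permCopies, hn', this]
        · rintro ⟨i, hi⟩
          exact hn (by simpa using (congrArg Prod.fst (e.injective hi)).symm)
    · rw [Perm.viaEmbedding_apply_of_notMem _ _ _ hx, Perm.viaEmbedding_apply_of_notMem]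
      rintro ⟨i, rfl⟩
      exact hx ⟨_, rfl⟩

theorem exists_perm_comp_embedding {κ μ : ℕ ↪ ℕ} (hκ : (Set.range κ)ᶜ.Infinite)
    (hμ : (Set.range μ)ᶜ.Infinite) : ∃ t : Perm ℕ, ∀ j, t (κ j) = μ j := by
  classical
  have : Infinite ((Set.range κ)ᶜ : Set ℕ) := hκ.to_subtype
  have : Infinite ((Set.range μ)ᶜ : Set ℕ) := hμ.to_subtype
  obtain ⟨e⟩ : Nonempty (((Set.range κ)ᶜ : Set ℕ) ≃ ((Set.range μ)ᶜ : Set ℕ)) :=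
    nonempty_equiv_of_countable
  let f : Set.range κ ≃ Set.range μ :=
    (Equiv.ofInjective κ κ.injective).symm.trans (Equiv.ofInjective μ μ.injective)
  refine ⟨(Equiv.Set.sumCompl _).symm.trans ((Equiv.sumCongr f e).trans (Equiv.Set.sumCompl _)),
    fun j => ?_⟩
  have : (Equiv.ofInjective κ κ.injective).symm ⟨κ j, Set.mem_range_self j⟩ = j := by
    rw [Equiv.symm_apply_eq]; rfl
  simp [Equiv.Set.sumCompl_symm_apply_of_mem (Set.mem_range_self j), f, this]

theorem mem_of_infinite_fixed {N : Subgroup (Perm ℕ)} [N.Normal] {g : Perm ℕ} (hgN : g ∈ N)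
    (hg : {x | g x ≠ x}.Infinite) {f : Perm ℕ} (hf : {x | f x = x}.Infinite) : f ∈ N := by
  obtain ⟨κ, hκ, hκN⟩ := exists_viaEmbedding_mem hgN hg
  have : Infinite {x | f x = x} := hf.to_subtype
  obtain ⟨φ⟩ : Nonempty ((ℕ ⊕ ℕ) ≃ {x | f x = x}) := nonempty_equiv_of_countable
  let A : Set ℕ := Set.range fun j : ℕ => (φ (Sum.inl j) : ℕ)
  have hA : A.Infinite := Set.infinite_range_of_injective fun i j h => by
    simpa using φ.injective (Subtype.ext h)
  have hAc : Aᶜ.Infinite := by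
    refine Set.Infinite.mono (s := Set.range fun j : ℕ => (φ (Sum.inr j) : ℕ)) ?_
      (Set.infinite_range_of_injective fun i j h => by simpa using φ.injective (Subtype.ext h))
    rintro _ ⟨j, rfl⟩ ⟨i, hi⟩
    simpa using φ.injective (Subtype.ext hi)
  have hfA : ∀ x ∈ A, f x = x := by
    rintro _ ⟨j, rfl⟩
    exact (φ (Sum.inl j)).2
  have : Infinite (Aᶜ : Set ℕ) := hAc.to_subtype
  obtain ⟨ψ⟩ : Nonempty (ℕ ≃ (Aᶜ : Set ℕ)) := nonempty_equiv_of_countable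
  let μ : ℕ ↪ ℕ := ψ.toEmbedding.trans (Function.Embedding.subtype _)
  have hμ : Set.range μ = Aᶜ := by
    ext x
    constructor
    · rintro ⟨j, rfl⟩
      exact (ψ j).2
    · exact fun hx => ⟨ψ.symm ⟨x, hx⟩, by simp [μ]⟩
  obtain ⟨t, ht⟩ := exists_perm_comp_embedding hκ (μ := μ) (by rwa [hμ, compl_compl])
  have hfx : ∀ x, f x ∈ Aᶜ ↔ x ∈ Aᶜ := by
    intro x
    simp only [Set.mem_compl_iff, not_iff_not]
    constructor
    · intro h
      have := f.injective (hfA _ h)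
      rwa [this] at h
    · intro h
      rwa [hfA _ h]
  let τ : Perm ℕ := (ψ.trans (f.subtypePerm hfx)).trans ψ.symm
  have := ‹N.Normal›.conj_mem _ (hκN τ) t
  convert this using 1
  rw [eq_mul_inv_iff_mul_eq]
  refine Equiv.ext fun x => ?_
  by_cases hx : x ∈ Set.range κ
  · obtain ⟨j, rfl⟩ := hx
    rw [Perm.mul_apply, Perm.mul_apply, Perm.viaEmbedding_apply, ht, ht]
    simp [μ, τ]
  · rw [Perm.mul_apply, Perm.mul_apply, Perm.viaEmbedding_apply_of_notMem _ _ _ hx]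
    apply hfA
    by_contra h
    rw [← Set.mem_compl_iff, ← hμ] at h
    obtain ⟨j, hj⟩ := h
    rw [← ht] at hj
    exact hx ⟨j, t.injective hj⟩

theorem eq_top_of_infinite_support {N : Subgroup (Perm ℕ)} [N.Normal] {g : Perm ℕ} (hgN : g ∈ N)
    (hg : {x | g x ≠ x}.Infinite) : N = ⊤ := by
  classical
  rw [eq_top_iff]
  rintro f -
  by_cases hf : {x | f x ≠ x}.Infinite
  · obtain ⟨z, hz⟩ := exists_injective_seq_of_infinite_support hf
    let Z : Set ℕ := Set.range fun n => z (2 * n)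
    have hZ : ∀ x ∈ Z, f x ∉ Z := by
      rintro _ ⟨n, rfl⟩ ⟨m, hm⟩
      exact hz _ _ hm.symm
    let T : ℕ → ℕ := fun x => if x ∈ Z then f x else if f.symm x ∈ Z then f.symm x else x
    have hT : Function.Involutive T := by
      intro x
      by_cases h1 : x ∈ Z
      · simp [T, h1, hZ x h1]
      · by_cases h2 : f.symm x ∈ Z <;> simp [T, h1, h2]
    let t : Perm ℕ := hT.toPerm
    have hodd : ∀ n, z (2 * n + 1) ∉ Z := by
      rintro n ⟨m, hm⟩
      have := z.injective hm
      omega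
    have ht : t ∈ N := by
      refine mem_of_infinite_fixed hgN hg (Set.Infinite.mono
        (s := Set.range fun n => z (2 * n + 1)) ?_
        (Set.infinite_range_of_injective fun i j h => by simpa using z.injective h))
      rintro _ ⟨n, rfl⟩
      have : f.symm (z (2 * n + 1)) ∉ Z := by
        rintro ⟨m, hm⟩
        exact hz _ _ (f.eq_symm_apply.mp hm)
      change T _ = _
      simp [T, hodd, this]
    have ht' : t⁻¹ * f ∈ N := by
      refine mem_of_infinite_fixed hgN hg (Set.Infinite.mono
        (s := Z) ?_ (Set.infinite_range_of_injective fun i j h => by simpa using z.injective h))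
      intro x hx
      change (t⁻¹ * f) x = x
      rw [Perm.mul_apply, Perm.inv_eq_iff_eq]
      change f x = T x
      simp [T, hx]
    simpa using N.mul_mem ht ht'
  · refine mem_of_infinite_fixed hgN hg ?_
    have : {x | f x = x} = {x | f x ≠ x}ᶜ := by ext; simp
    rw [this]
    exact (Set.not_infinite.mp hf).infinite_compl

end InfiniteSymmetric

section CountableSimple

open Equiv
open scoped commutatorElement

theorem countable_subgroup_closure {G : Type*} [Group G] {s : Set G} (hs : s.Countable) :
    Countable (Subgroup.closure s) := by
  have : Countable s := hs
  have : Countable (FreeGroup s) := inferInstanceAs (Countable (Quot _))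
  rw [FreeGroup.closure_eq_range]
  exact Set.countable_range (FreeGroup.lift ((↑) : s → G))

theorem exists_countable_conjugators {G : Type*} [Group G] (a b : G)
    (hb : b ∈ Subgroup.normalClosure {a}) :
    ∃ C : Set G, C.Countable ∧ b ∈ Subgroup.closure {x | ∃ c ∈ C, x = c * a * c⁻¹} := by
  have key : ∀ {C D : Set G}, C ⊆ D → Subgroup.closure {x | ∃ c ∈ C, x = c * a * c⁻¹} ≤
      Subgroup.closure {x | ∃ c ∈ D, x = c * a * c⁻¹} := fun h =>
    Subgroup.closure_mono fun x ⟨c, hc, hx⟩ => ⟨c, h hc, hx⟩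
  unfold Subgroup.normalClosure at hb
  induction hb using Subgroup.closure_induction with
  | mem x hx =>
    rw [Group.mem_conjugatesOfSet_iff] at hx
    obtain ⟨_, rfl, hx⟩ := hx
    obtain ⟨c, rfl⟩ := isConj_iff.mp hx
    exact ⟨{c}, Set.countable_singleton c, Subgroup.subset_closure ⟨c, rfl, rfl⟩⟩
  | one => exact ⟨∅, Set.countable_empty, one_mem _⟩
  | mul x y _ _ hx hy =>
    obtain ⟨C, hC, hx⟩ := hx
    obtain ⟨D, hD, hy⟩ := hy
    exact ⟨C ∪ D, hC.union hD, mul_mem (key Set.subset_union_left hx)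
      (key Set.subset_union_right hy)⟩
  | inv x _ hx =>
    obtain ⟨C, hC, hx⟩ := hx
    exact ⟨C, hC, inv_mem hx⟩

theorem exists_countable_simple_subgroup {U : Type*} [Group U] [IsSimpleGroup U]
    (S₀ : Subgroup U) [Countable S₀] [Nontrivial S₀] :
    ∃ S : Subgroup U, S₀ ≤ S ∧ Countable S ∧ IsSimpleGroup S := by
  have hC : ∀ a b : U, ∃ C : Set U, C.Countable ∧
      (a ≠ 1 → b ∈ Subgroup.closure {x | ∃ c ∈ C, x = c * a * c⁻¹}) := by
    intro a b
    by_cases ha : a = 1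
    · exact ⟨∅, Set.countable_empty, fun h => absurd ha h⟩
    · have : b ∈ Subgroup.normalClosure {a} := by
        rcases (Subgroup.normalClosure_normal (s := {a})).eq_bot_or_eq_top with h | h
        · exact absurd (Subgroup.mem_bot.mp
            (h ▸ Subgroup.subset_normalClosure (Set.mem_singleton a))) ha
        · rw [h]; trivial
      obtain ⟨C, hC, hb⟩ := exists_countable_conjugators a b this
      exact ⟨C, hC, fun _ => hb⟩
  choose C hCc hC using hC
  let step : Subgroup U → Subgroup U := fun K =>
    Subgroup.closure (K ∪ ⋃ a ∈ K, ⋃ b ∈ K, C a b)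
  have hle : ∀ K, K ≤ step K := fun K x hx => Subgroup.subset_closure (Or.inl hx)
  have hcount : ∀ K : Subgroup U, Countable K → Countable (step K) := by
    intro K hK
    have hK : (K : Set U).Countable := hK
    exact countable_subgroup_closure
      (hK.union (hK.biUnion fun a _ => hK.biUnion fun b _ => hCc a b))
  let T : ℕ → Subgroup U := fun n => step^[n] S₀
  have hT : ∀ n, T (n + 1) = step (T n) := fun n => Function.iterate_succ_apply' _ _ _
  have hmono : Monotone T := monotone_nat_of_le_succ fun n => by rw [hT]; exact hle _
  have hTc : ∀ n, Countable (T n) := by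
    intro n
    induction n with
    | zero => assumption
    | succ n ih => rw [hT]; exact hcount _ ih
  have hmem : ∀ {x}, x ∈ (⨆ n, T n) ↔ ∃ n, x ∈ T n :=
    Subgroup.mem_iSup_of_directed hmono.directed_le
  refine ⟨⨆ n, T n, le_iSup T 0, ?_, ?_⟩
  · have : ((⨆ n, T n : Subgroup U) : Set U) = ⋃ n, (T n : Set U) := by
      ext x
      simp [hmem]
    change ((⨆ n, T n : Subgroup U) : Set U).Countable
    rw [this]
    exact Set.countable_iUnion hTc
  · have : Nontrivial (⨆ n, T n : Subgroup U) := by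
      obtain ⟨x, hx⟩ := exists_ne (1 : S₀)
      exact ⟨⟨⟨x, le_iSup T 0 x.2⟩, 1, fun h => hx (Subtype.ext (by simpa using h))⟩⟩
    refine ⟨fun N hN => ?_⟩
    by_cases hbot : N = ⊥
    · exact Or.inl hbot
    right
    obtain ⟨⟨⟨a, ha⟩, haN⟩, ha1'⟩ := Subgroup.ne_bot_iff_exists_ne_one.mp hbot
    have ha1 : a ≠ 1 := fun h => ha1' (Subtype.ext (Subtype.ext h))
    rw [eq_top_iff]
    rintro ⟨b, hb⟩ -
    obtain ⟨n, han⟩ := hmem.mp ha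
    obtain ⟨m, hbm⟩ := hmem.mp hb
    have h1 := hC a b ha1
    have h2 : Subgroup.closure {x | ∃ c ∈ C a b, x = c * a * c⁻¹} ≤
        N.map (Subgroup.subtype _) := by
      rw [Subgroup.closure_le]
      rintro _ ⟨c, hc, rfl⟩
      have hc' : c ∈ ⨆ n, T n := by
        rw [hmem]
        refine ⟨max n m + 1, ?_⟩
        rw [hT]
        refine Subgroup.subset_closure (Or.inr ?_)
        simp only [Set.mem_iUnion]
        exact ⟨a, hmono (le_max_left _ _) han, b, hmono (le_max_right _ _) hbm, hc⟩
      exact ⟨⟨c, hc'⟩ * ⟨a, ha⟩ * ⟨c, hc'⟩⁻¹, hN.conj_mem _ haN _, rfl⟩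
    obtain ⟨y, hy, hyb⟩ := h2 h1
    have : y = ⟨b, hb⟩ := Subtype.ext hyb
    exact this ▸ hy

/-- The permutations of `ℕ` with finite support. -/
def finitaryPerm : Subgroup (Perm ℕ) where
  carrier := {f | {x | f x ≠ x}.Finite}
  one_mem' := by simp
  mul_mem' {f g} hf hg := (hf.union hg).subset fun x hx => by
    by_contra h
    simp only [Set.mem_union, Set.mem_ofPred_eq, not_or, not_not] at h
    exact hx (by rw [Perm.mul_apply, h.2, h.1])
  inv_mem' {f} hf := hf.subset fun x hx h => hx (by rw [Perm.inv_eq_iff_eq, h])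

instance : finitaryPerm.Normal where
  conj_mem f hf g := by
    refine (Set.Finite.image g hf).subset fun x hx => ?_
    refine ⟨g⁻¹ x, fun h => hx ?_, by simp⟩
    rw [Perm.mul_apply, Perm.mul_apply, h]
    simp

instance : IsSimpleGroup (Perm ℕ ⧸ finitaryPerm) := by
  have : Nontrivial (Perm ℕ ⧸ finitaryPerm) := by
    rw [QuotientGroup.nontrivial_iff]
    intro h
    let f : ℕ → ℕ := fun x => if x % 2 = 0 then x + 1 else x - 1
    have hf : Function.Involutive f := by
      intro x
      simp only [f]
      split_ifs <;> omega
    have h1 : hf.toPerm ∈ finitaryPerm := h ▸ Subgroup.mem_top _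
    refine Set.infinite_univ (h1.subset fun x _ => ?_)
    change f x ≠ x
    simp only [f]
    split_ifs <;> omega
  refine ⟨fun N hN => ?_⟩
  by_cases hbot : N = ⊥
  · exact Or.inl hbot
  right
  obtain ⟨⟨x, hx⟩, hx1⟩ := Subgroup.ne_bot_iff_exists_ne_one.mp hbot
  obtain ⟨g, rfl⟩ := QuotientGroup.mk'_surjective _ x
  have hg : {x | g x ≠ x}.Infinite := by
    intro h
    refine hx1 (Subtype.ext ?_)
    exact (QuotientGroup.eq_one_iff g).mpr h
  have := eq_top_of_infinite_support (N := N.comap (QuotientGroup.mk' finitaryPerm)) hx hg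
  rw [eq_top_iff]
  intro y _
  obtain ⟨f, rfl⟩ := QuotientGroup.mk'_surjective _ y
  have hf : f ∈ N.comap (QuotientGroup.mk' finitaryPerm) := this ▸ Subgroup.mem_top _
  exact hf

theorem exists_injective_hom_perm_quotient (Q : Type) [Group Q] [Countable Q] :
    ∃ f : Q →* Perm ℕ ⧸ finitaryPerm, Function.Injective f := by
  obtain ⟨e⟩ : Nonempty (Q × ℕ ≃ ℕ) := nonempty_equiv_of_countable
  let f : Q →* Perm ℕ := (e.permCongrHom.toMonoidHom).comp
    (MonoidHom.mk' (fun q => (Equiv.mulLeft q).prodCongr (Equiv.refl ℕ)) fun a b => by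
      ext p <;> simp [mul_assoc])
  refine ⟨(QuotientGroup.mk' _).comp f, (injective_iff_map_eq_one _).mpr fun q hq => ?_⟩
  by_contra hq1
  have h : f q ∈ finitaryPerm := (QuotientGroup.eq_one_iff _).mp hq
  refine Set.infinite_univ (h.subset fun x _ => ?_)
  obtain ⟨⟨p, n⟩, rfl⟩ := e.surjective x
  intro h
  have : e ((q * p), n) = e (p, n) := by simpa [f] using h
  simpa [hq1] using e.injective this

/-- Every countable group embeds in a countable infinite nonabelian simple group. -/
theorem exists_countable_simple (Q : Type) [Group Q] [Countable Q] :
    ∃ (S : Type) (_ : Group S), Countable S ∧ Infinite S ∧ IsSimpleGroup S ∧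
      commutator S = ⊤ ∧ ∃ f : Q →* S, Function.Injective f := by
  have : Countable (FreeGroup (Fin 2)) := inferInstanceAs (Countable (Quot _))
  obtain ⟨f, hf⟩ := exists_injective_hom_perm_quotient (Q × FreeGroup (Fin 2))
  have : Countable f.range := Set.countable_range f
  have : Nontrivial f.range := (MonoidHom.ofInjective hf).symm.toEquiv.nontrivial
  obtain ⟨S, hS, hSc, hSs⟩ := exists_countable_simple_subgroup f.range
  let g : Q × FreeGroup (Fin 2) →* S := f.codRestrict S fun x => hS ⟨x, rfl⟩
  have hg : Function.Injective g := fun a b h => hf (congrArg Subtype.val h)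
  refine ⟨S, inferInstance, hSc, Infinite.of_injective g hg, hSs, ?_,
    g.comp (MonoidHom.inl Q _), hg.comp fun a b h => by simpa using h⟩
  rcases (inferInstance : (commutator S).Normal).eq_bot_or_eq_top with h | h
  · exfalso
    have h1 : ⁅g (1, FreeGroup.of 0), g (1, FreeGroup.of 1)⁆ ∈ commutator S :=
      Subgroup.commutator_mem_commutator (Subgroup.mem_top _) (Subgroup.mem_top _)
    rw [h, Subgroup.mem_bot, ← map_commutatorElement, map_eq_one_iff g hg,
      commutatorElement_eq_one_iff_mul_comm] at h1
    have h2 : FreeGroup.of (0 : Fin 2) * FreeGroup.of 1 = FreeGroup.of 1 * FreeGroup.of 0 :=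
      congrArg Prod.snd h1
    have := congrArg FreeGroup.toWord h2
    revert this
    decide
  · exact h

end CountableSimple

section TwoGenerated

open scoped commutatorElement

theorem eq_of_three_pow_add_eq {i j k l : ℕ} (h : 3 ^ i + 3 ^ l = 3 ^ j + 3 ^ k) (hij : i ≠ j) :
    i = k := by
  have key : ∀ {a b : ℕ}, a < b → 3 * 3 ^ a ≤ 3 ^ b := fun {a b} hab => by
    rw [← pow_succ']
    exact Nat.pow_le_pow_right (by norm_num) hab
  have hpos : ∀ a : ℕ, 0 < 3 ^ a := fun a => by positivity
  have hinj : ∀ {a b : ℕ}, 3 ^ a = 3 ^ b → a = b := fun h =>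
    Nat.pow_right_injective (le_refl 2 |>.trans (by norm_num)) h
  by_contra hik
  have hi := hpos i
  have hj := hpos j
  have hk := hpos k
  have hl := hpos l
  by_cases hlj : l = j
  · subst hlj
    exact hik (hinj (by omega))
  by_cases hlk : l = k
  · subst hlk
    exact hij (hinj (by omega))
  rcases lt_or_gt_of_ne hij with h1 | h1 <;> rcases lt_or_gt_of_ne hik with h2 | h2 <;>
  rcases lt_or_gt_of_ne hlj with h3 | h3 <;> rcases lt_or_gt_of_ne hlk with h4 | h4 <;>
  · have := key h1
    have := key h2
    have := key h3
    have := key h4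
    omega

theorem exists_positions (S : Type*) [Group S] [Countable S] :
    ∃ β : Multiplicative ℤ → S, ∀ s t : S, ∃ x y : Multiplicative ℤ,
      ∀ z, ⁅β (x * z), β (y * z)⁆ = Pi.mulSingle (M := fun _ => S) 1 ⁅s, t⁆ z := by
  classical
  obtain ⟨σ, hσ⟩ := exists_surjective_nat S
  let p : ℕ → Multiplicative ℤ := fun i => Multiplicative.ofAdd ((3 : ℤ) ^ i)
  have hp : ∀ i j k l, p i * p l = p j * p k → i ≠ j → i = k := by
    intro i j k l h hij
    have h' : (3 : ℤ) ^ i + 3 ^ l = 3 ^ j + 3 ^ k := h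
    exact eq_of_three_pow_add_eq (by exact_mod_cast h') hij
  have hpinj : Function.Injective p := by
    intro i j h
    have h' : (3 : ℤ) ^ i = 3 ^ j := h
    exact Nat.pow_right_injective (le_refl 2 |>.trans (by norm_num) : 2 ≤ 3) (by exact_mod_cast h')
  refine ⟨Function.extend p σ 1, fun s t => ?_⟩
  obtain ⟨i, rfl⟩ := hσ s
  obtain ⟨j, rfl⟩ := hσ t
  refine ⟨p i, p j, fun z => ?_⟩
  by_cases hz : z = 1
  · subst hz
    simp [hpinj.extend_apply]
  · rw [Pi.mulSingle_eq_of_ne hz, commutatorElement_eq_one_iff_mul_comm]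
    by_cases hij : i = j
    · rw [hij]
    by_cases h1 : ∃ k, p k = p i * z
    · by_cases h2 : ∃ l, p l = p j * z
      · exfalso
        obtain ⟨k, hk⟩ := h1
        obtain ⟨l, hl⟩ := h2
        have := hp i j k l (by rw [hk, hl, mul_left_comm]) hij
        rw [this] at hk
        exact hz (left_eq_mul.mp hk)
      · rw [Function.extend_apply' _ _ (p j * z) h2]
        simp
    · rw [Function.extend_apply' _ _ (p i * z) h1]
      simp

theorem exists_simple_le_range (Q : Type) [Group Q] [Countable Q] :
    ∃ (E S : Type) (_ : Group E) (_ : Group S) (e : FreeGroup (Fin 2) →* E) (j : S →* E)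
      (f : Q →* S), Function.Injective j ∧ j.range ≤ e.range ∧ IsSimpleGroup S ∧ Infinite S ∧
        Function.Injective f := by
  obtain ⟨S, _, hSc, hSi, hSs, hcomm, f, hf⟩ := exists_countable_simple Q
  obtain ⟨β, hβ⟩ := exists_positions S
  let b : S ≀ᵣ Multiplicative ℤ := ⟨β, 1⟩
  let t : S ≀ᵣ Multiplicative ℤ := ⟨1, Multiplicative.ofAdd 1⟩
  let e : FreeGroup (Fin 2) →* S ≀ᵣ Multiplicative ℤ := FreeGroup.lift ![t, b]
  let j : S →* S ≀ᵣ Multiplicative ℤ := MonoidHom.mk' (fun s => ⟨Pi.mulSingle (M := fun _ => S) 1 s, 1⟩) fun x y => by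
    ext1
    · simp [Pi.mulSingle_mul]
    · simp
  refine ⟨S ≀ᵣ Multiplicative ℤ, S, inferInstance, inferInstance, e, j, f, ?_, ?_, hSs, hSi, hf⟩
  · intro x y hxy
    exact Pi.mulSingle_injective _ (congrArg RegularWreathProduct.left hxy)
  · have ht : t ∈ e.range := ⟨FreeGroup.of 0, by simp [e]⟩
    have hb : b ∈ e.range := ⟨FreeGroup.of 1, by simp [e]⟩
    have hinl : ∀ x : Multiplicative ℤ, (RegularWreathProduct.inl x : S ≀ᵣ Multiplicative ℤ) ∈ e.range := by
      intro x
      have : (RegularWreathProduct.inl x : S ≀ᵣ Multiplicative ℤ) = t ^ (Multiplicative.toAdd x) := by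
        have : t = RegularWreathProduct.inl (Multiplicative.ofAdd 1) := rfl
        rw [this, ← map_zpow, ← ofAdd_zsmul]
        simp
      rw [this]
      exact zpow_mem ht _
    rw [MonoidHom.range_eq_map, ← hcomm, commutator_eq_closure, MonoidHom.map_closure,
      Subgroup.closure_le]
    rintro _ ⟨_, ⟨s, s', rfl⟩, rfl⟩
    obtain ⟨x, y, hxy⟩ := hβ s s'
    have hconj : ∀ x : Multiplicative ℤ, (⟨fun z => β (x * z), 1⟩ : S ≀ᵣ Multiplicative ℤ) ∈ e.range := by
      intro x
      have : (⟨fun z => β (x * z), 1⟩ : S ≀ᵣ Multiplicative ℤ) =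
          RegularWreathProduct.inl x⁻¹ * b * (RegularWreathProduct.inl x⁻¹)⁻¹ := by
        ext z <;> simp [b]
      rw [this]
      exact mul_mem (mul_mem (hinl _) hb) (inv_mem (hinl _))
    have : j ⁅s, s'⁆ = ⁅(⟨fun z => β (x * z), 1⟩ : S ≀ᵣ Multiplicative ℤ), ⟨fun z => β (y * z), 1⟩⁆ := by
      ext z
      · have := hxy z
        simp only [commutatorElement_def] at this
        simp [commutatorElement_def, j, this]
      · simp [commutatorElement_def, j]
    rw [this, commutatorElement_def]
    exact mul_mem (mul_mem (mul_mem (hconj _) (hconj _)) (inv_mem (hconj _))) (inv_mem (hconj _))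

end TwoGenerated

section Transfer

/-- A maximal normal subgroup meeting the copy of `S` trivially. -/
theorem exists_maximal_normal_disjoint {C E S : Type*} [Group C] [Group E] [Group S]
    [IsSimpleGroup S] (q : C →* E) (j : S →* E) (hj : Function.Injective j)
    (hjq : j.range ≤ q.range) :
    ∃ N : Subgroup C, N.Normal ∧ q.ker ≤ N ∧ (∀ c ∈ N, ∀ s, q c = j s → s = 1) ∧
      ∀ L : Subgroup C, L.Normal → ¬ L ≤ N →
        ∀ s, ∃ l ∈ L, ∃ c, q c = j s ∧ c * l⁻¹ ∈ N := by
  let P : Set (Subgroup C) := {N | N.Normal ∧ ∀ c ∈ N, ∀ s, q c = j s → s = 1}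
  have hker : q.ker ∈ P := by
    refine ⟨inferInstance, fun c hc s hs => hj ?_⟩
    rw [← hs, map_one]
    exact hc
  obtain ⟨N, hkN, hN⟩ := zorn_le_nonempty₀ P (by
    intro c hcP hc y hy
    have hne : c.Nonempty := ⟨y, hy⟩
    have hmem : ∀ {x}, x ∈ sSup c ↔ ∃ K ∈ c, x ∈ K :=
      Subgroup.mem_sSup_of_directedOn hne hc.directedOn
    refine ⟨sSup c, ⟨⟨fun n hn g => ?_⟩, fun x hx => ?_⟩, fun z hz => le_sSup hz⟩
    · obtain ⟨K, hK, hn⟩ := hmem.mp hn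
      exact hmem.mpr ⟨K, hK, (hcP hK).1.conj_mem n hn g⟩
    · obtain ⟨K, hK, hx⟩ := hmem.mp hx
      exact (hcP hK).2 x hx) q.ker hker
  have hNn : N.Normal := hN.prop.1
  refine ⟨N, hNn, hkN, hN.prop.2, fun L hL hLN s => ?_⟩
  have hnot : ¬ (N ⊔ L) ∈ P := fun h =>
    hLN (le_sup_right.trans (hN.le_of_ge h le_sup_left))
  let T : Subgroup S := ((N ⊔ L).map q).comap j
  have hTn : T.Normal := ⟨fun t ⟨c, hc, hct⟩ x => by
    obtain ⟨d, hd⟩ := hjq ⟨x, rfl⟩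
    refine ⟨d * c * d⁻¹, (inferInstance : (N ⊔ L).Normal).conj_mem c hc d, ?_⟩
    simp [hd, hct]⟩
  have hT : T = ⊤ := by
    refine hTn.eq_bot_or_eq_top.resolve_left fun hbot => hnot ⟨inferInstance, fun c hc t ht => ?_⟩
    have : t ∈ T := ⟨c, hc, ht⟩
    rwa [hbot, Subgroup.mem_bot] at this
  obtain ⟨c, hc, hcs⟩ : s ∈ T := hT ▸ Subgroup.mem_top s
  obtain ⟨n, hn, l, hl, rfl⟩ := Subgroup.mem_sup_of_normal_left.mp hc
  exact ⟨l, hl, n * l, hcs, by simpa using hn⟩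

theorem exists_inf_eq_and_not_le {C : Type*} [Group C] {G : Type*} [Group G]
    (α : G →* MulAut C) (N : Subgroup C) (hN : N.Normal) (hne : N ≠ ⊤)
    (hfin : (Set.range fun g => N.map (α g).toMonoidHom).Finite) :
    ∃ L : Subgroup C, L.Normal ∧ ¬ L ≤ N ∧
      L ⊓ N = ⨅ g, N.map (α g).toMonoidHom := by
  classical
  let M := ⨅ g, N.map (α g).toMonoidHom
  have hM : ∀ g, M.map (α g).toMonoidHom = M := by
    intro g
    have hle : ∀ g, M ≤ M.map (α g).toMonoidHom := by
      intro g x hx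
      refine ⟨α g⁻¹ x, ?_, by simp⟩
      refine Subgroup.mem_iInf.mpr fun h => ?_
      obtain ⟨y, hy, rfl⟩ := Subgroup.mem_iInf.mp hx (g * h)
      exact ⟨y, hy, by simp⟩
    refine le_antisymm ?_ (hle g)
    have := Subgroup.map_mono (f := (α g).toMonoidHom) (hle g⁻¹)
    rw [Subgroup.map_map] at this
    have h1 : (α g).toMonoidHom.comp (α g⁻¹).toMonoidHom = MonoidHom.id C := by
      ext x; simp
    rwa [h1, Subgroup.map_id] at this
  let X : Finset (Subgroup C) := hfin.toFinset
  have hX : ∀ K ∈ X, ∃ g, N.map (α g).toMonoidHom = K := fun K hK => hfin.mem_toFinset.mp hK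
  let P : Set (Finset (Subgroup C)) := {I | I ⊆ X ∧ I.inf id = M}
  have hP : P.Nonempty := by
    refine ⟨X, subset_rfl, le_antisymm (le_iInf fun g => ?_) (Finset.le_inf fun K hK => ?_)⟩
    · exact Finset.inf_le (f := id) (hfin.mem_toFinset.mpr ⟨g, rfl⟩)
    · obtain ⟨g, rfl⟩ := hX K hK
      exact iInf_le _ g
  obtain ⟨I, hI, hmin⟩ := wellFounded_lt.has_min P hP
  have hIne : I.Nonempty := by
    rw [Finset.nonempty_iff_ne_empty]
    rintro rfl
    have h1 : (⊤ : Subgroup C) = M := hI.2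
    have h2 : M ≤ N.map (α 1).toMonoidHom := iInf_le _ 1
    rw [← h1, map_one] at h2
    refine hne (top_le_iff.mp (h2.trans ?_))
    rintro _ ⟨y, hy, rfl⟩
    exact hy
  obtain ⟨K, hK⟩ := hIne
  obtain ⟨g, rfl⟩ := hX K (hI.1 hK)
  let L := (I.erase (N.map (α g).toMonoidHom)).inf id
  have hLK : L ⊓ N.map (α g).toMonoidHom = M := by
    rw [← hI.2, ← Finset.insert_erase hK, Finset.inf_insert, inf_comm]
    simp [L]
  have hLn : L.Normal := by
    refine ⟨fun n hn c => ?_⟩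
    have h1 : ∀ K ∈ I.erase (N.map (α g).toMonoidHom), n ∈ K := fun K hK =>
      (Finset.inf_le (f := id) hK : L ≤ K) hn
    have h2 : Subgroup.zpowers (c * n * c⁻¹) ≤ L := by
      refine Finset.le_inf fun K hK => ?_
      obtain ⟨g, rfl⟩ := hX K (hI.1 (Finset.mem_of_mem_erase hK))
      rw [Subgroup.zpowers_le]
      exact (hN.map _ (α g).surjective).conj_mem n (h1 _ hK) c
    exact h2 (Subgroup.mem_zpowers _)
  have hLnot : ¬ L ≤ N.map (α g).toMonoidHom := by
    intro h
    refine hmin (I.erase (N.map (α g).toMonoidHom)) ⟨(Finset.erase_subset _ _).trans hI.1, ?_⟩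
      (Finset.erase_ssubset hK)
    rw [← hLK]
    exact (inf_eq_left.mpr h).symm
  have hinv : (N.map (α g).toMonoidHom).map (α g⁻¹).toMonoidHom = N := by
    rw [Subgroup.map_map]
    have h1 : (α g⁻¹).toMonoidHom.comp (α g).toMonoidHom = MonoidHom.id C := by
      ext x; simp
    rw [h1, Subgroup.map_id]
  refine ⟨L.map (α g⁻¹).toMonoidHom, hLn.map _ (α g⁻¹).surjective, ?_, ?_⟩
  · intro h
    rw [← hinv] at h
    exact hLnot ((Subgroup.map_le_map_iff_of_injective (α g⁻¹).injective).mp h)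
  · change _ = M
    rw [← hM g⁻¹, ← hLK, Subgroup.map_inf _ _ _ (α g⁻¹).injective, hinv]

theorem eq_top_of_finiteIndex_of_isSimpleGroup {S : Type*} [Group S] [IsSimpleGroup S] [Infinite S]
    (H : Subgroup S) [H.FiniteIndex] : H = ⊤ := by
  rcases H.normalCore_normal.eq_bot_or_eq_top with h | h
  · have : (⊥ : Subgroup S).FiniteIndex := h ▸ inferInstance
    have h2 := Subgroup.index_bot (G := S)
    have h3 := Subgroup.FiniteIndex.index_ne_zero (H := (⊥ : Subgroup S))
    simp at h2 h3
  · exact top_le_iff.mp (h ▸ H.normalCore_le)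

/-- Virtually large groups are SQ-universal. -/
theorem IsVirtuallyLarge.sqUniversal {G : Type*} [Group G] (hG : IsVirtuallyLarge G) :
    SQUniversal G := by
  intro Q _ _
  obtain ⟨H, hH, F, hF⟩ := hG
  obtain ⟨E, S, _, _, e, j, f, hj, hje, hS, hSi, hf⟩ := exists_simple_le_range Q
  let C := H.normalCore
  let q : C →* E := (e.comp F).comp (Subgroup.inclusion H.normalCore_le)
  have hjq : j.range ≤ q.range := by
    have hfi : (C.subgroupOf H).FiniteIndex := inferInstance
    have h1 : ((C.subgroupOf H).map F).FiniteIndex := finiteIndex_map F hF _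
    have h2 := finiteIndex_map_subgroupOf_range e ((C.subgroupOf H).map F)
    have h3 : (((C.subgroupOf H).map F).map e).relIndex e.range ≠ 0 :=
      Subgroup.FiniteIndex.index_ne_zero
    have h4 : (((C.subgroupOf H).map F).map e).relIndex j.range ≠ 0 :=
      fun h => h3 (Subgroup.relIndex_eq_zero_of_le_right hje h)
    have h5 : ((((C.subgroupOf H).map F).map e).comap j).FiniteIndex := by
      rw [Subgroup.finiteIndex_iff, Subgroup.index_comap]
      exact h4
    have h6 := eq_top_of_finiteIndex_of_isSimpleGroup ((((C.subgroupOf H).map F).map e).comap j)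
    rintro _ ⟨s, rfl⟩
    have : s ∈ (((C.subgroupOf H).map F).map e).comap j := h6 ▸ Subgroup.mem_top s
    obtain ⟨_, ⟨y, hy, rfl⟩, hys⟩ := this
    exact ⟨⟨y, hy⟩, hys⟩
  obtain ⟨N, hN, hkN, hNj, hmax⟩ := exists_maximal_normal_disjoint q j hj hjq
  let α : G →* MulAut C := MulAut.conjNormal
  have hNne : N ≠ ⊤ := by
    intro h
    obtain ⟨s, hs⟩ := exists_ne (1 : S)
    obtain ⟨c, hc⟩ := hjq ⟨s, rfl⟩
    exact hs (hNj c (h ▸ Subgroup.mem_top c) s hc)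
  have hcoset : ∀ (g : G) (c : C), N.map (α (g * c)).toMonoidHom = N.map (α g).toMonoidHom := by
    have hle : ∀ (g : G) (c : C),
        N.map (α (g * c)).toMonoidHom ≤ N.map (α g).toMonoidHom := by
      rintro g c _ ⟨x, hx, rfl⟩
      refine ⟨c * x * c⁻¹, hN.conj_mem x hx c, ?_⟩
      ext
      simp [α, mul_assoc]
    intro g c
    refine le_antisymm (hle g c) ?_
    simpa using hle (g * c) c⁻¹
  have hfin : (Set.range fun g => N.map (α g).toMonoidHom).Finite := by
    refine (Set.finite_range fun x : G ⧸ C => N.map (α x.out).toMonoidHom).subset ?_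
    rintro _ ⟨g, rfl⟩
    obtain ⟨c, hc⟩ := QuotientGroup.mk_out_eq_mul C g
    exact ⟨(g : G ⧸ C), by simp only [hc, hcoset]⟩
  obtain ⟨L, hL, hLN, hLM⟩ := exists_inf_eq_and_not_le α N hN hNne hfin
  let M : Subgroup C := ⨅ g, N.map (α g).toMonoidHom
  replace hLM : L ⊓ N = M := hLM
  have hMn : (M.map C.subtype).Normal := by
    refine ⟨?_⟩
    rintro _ ⟨m, hm, rfl⟩ g
    refine ⟨α g m, Subgroup.mem_iInf.mpr fun h => ?_, by simp [α]⟩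
    obtain ⟨y, hy, hym⟩ := Subgroup.mem_iInf.mp hm (g⁻¹ * h)
    exact ⟨y, hy, by rw [← hym]; simp⟩
  choose l hl c hc hcl using hmax L hL hLN
  have hmul : ∀ s t, l s * l t * (l (s * t))⁻¹ ∈ M := by
    intro s t
    rw [← hLM]
    refine ⟨L.mul_mem (L.mul_mem (hl s) (hl t)) (L.inv_mem (hl _)), ?_⟩
    change l s * l t * (l (s * t))⁻¹ ∈ N
    have h1 : ∀ s, (l s : C ⧸ N) = c s := fun s => by
      rw [eq_comm, QuotientGroup.eq_iff_div_mem, div_eq_mul_inv]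
      exact hcl s
    rw [← QuotientGroup.eq_one_iff, QuotientGroup.mk_mul, QuotientGroup.mk_mul,
      QuotientGroup.mk_inv, h1, h1, h1, ← QuotientGroup.mk_mul, ← QuotientGroup.mk_inv,
      ← QuotientGroup.mk_mul, QuotientGroup.eq_one_iff]
    apply hkN
    simp [MonoidHom.mem_ker, hc]
  let ψ : S →* G ⧸ M.map C.subtype := MonoidHom.mk' (fun s => ((l s : G) : G ⧸ M.map C.subtype))
    fun s t => by
      rw [← QuotientGroup.mk_mul, eq_comm, QuotientGroup.eq_iff_div_mem, div_eq_mul_inv]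
      exact ⟨_, hmul s t, by simp⟩
  have hψ : Function.Injective ψ := by
    rw [injective_iff_map_eq_one]
    intro s hs
    obtain ⟨m, hm, hms⟩ := (QuotientGroup.eq_one_iff _).mp hs
    have h1 : m = l s := Subtype.ext hms
    have h2 : l s ∈ N := by
      rw [← h1]
      change m ∈ M at hm
      rw [← hLM] at hm
      exact hm.2
    refine hNj (c s) ?_ s (hc s)
    simpa using mul_mem (hcl s) h2
  exact ⟨M.map C.subtype, hMn, ψ.comp f, hψ.comp hf⟩

end Transfer

section Rigidity

open Monoid Monoid.CoprodI

theorem relIndex_ne_zero_of_finite_invariant {G X : Type*} [Group G] [Finite X] (H K : Subgroup G)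
    (R : G → X → Prop) (hK : ∀ g ∈ K, ∃ x, R g x)
    (hR : ∀ g g' x, R g x → R g' x → g * g'⁻¹ ∈ H) : H.relIndex K ≠ 0 := by
  obtain ⟨x₁, -⟩ := hK 1 K.one_mem
  have : Nonempty X := ⟨x₁⟩
  choose! r hr using hK
  have hinj : Function.Injective fun q : K ⧸ H.subgroupOf K => r ((q.out : K) : G)⁻¹ := by
    intro q q' h
    have h1 := hr _ (K.inv_mem q.out.2)
    have h2 := hr _ (K.inv_mem q'.out.2)
    rw [show r ((q.out : K) : G)⁻¹ = r ((q'.out : K) : G)⁻¹ from h] at h1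
    rw [← QuotientGroup.out_eq' q, ← QuotientGroup.out_eq' q', QuotientGroup.eq,
      Subgroup.mem_subgroupOf]
    simpa using hR _ _ _ h1 h2
  have : Finite (K ⧸ H.subgroupOf K) := Finite.of_injective _ hinj
  exact (Subgroup.finiteIndex_of_finite_quotient (H := H.subgroupOf K)).index_ne_zero

/-- Automorphisms of `W` leaving invariant the homomorphism `f`. -/
def mulAutStabilizer {W K : Type*} [Group W] [Group K] (f : W →* K) : Subgroup (MulAut W) where
  carrier := {φ | ∀ x, f (φ x) = f x}
  mul_mem' := fun {φ ψ} hφ hψ x => by rw [MulAut.mul_apply, hφ, hψ]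
  one_mem' := fun x => rfl
  inv_mem' := fun {φ} hφ x => by
    have := hφ (φ⁻¹ x)
    rw [MulAut.apply_inv_self] at this
    exact this.symm

theorem finiteIndex_mulAutStabilizer {W K : Type*} [Group W] [Group K] [Finite (W →* K)]
    (f : W →* K) : (mulAutStabilizer f).FiniteIndex := by
  rw [Subgroup.finiteIndex_iff, ← Subgroup.relIndex_top_right]
  refine relIndex_ne_zero_of_finite_invariant _ _
    (fun φ g => g = f.comp φ.toMonoidHom) (fun φ _ => ⟨_, rfl⟩) ?_
  rintro φ ψ _ rfl h x
  have := DFunLike.congr_fun h (ψ⁻¹ x)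
  simp only [MonoidHom.comp_apply, MulEquiv.toMonoidHom_eq_coe, MonoidHom.coe_coe,
    MulAut.apply_inv_self] at this
  rw [MulAut.mul_apply, this]

/-- Automorphisms of `W` preserving the homomorphism `f` up to inner automorphisms. -/
def mulAutConjStabilizer {W K : Type*} [Group W] [Group K] (f : W →* K) : Subgroup (MulAut W) where
  carrier := {φ | ∃ p, ∀ x, f (φ x) = p * f x * p⁻¹}
  mul_mem' := by
    rintro φ ψ ⟨p, hp⟩ ⟨q, hq⟩
    exact ⟨p * q, fun x => by rw [MulAut.mul_apply, hp, hq]; group⟩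
  one_mem' := ⟨1, fun x => by simp⟩
  inv_mem' := by
    rintro φ ⟨p, hp⟩
    refine ⟨p⁻¹, fun x => ?_⟩
    have := hp (φ⁻¹ x)
    rw [MulAut.apply_inv_self] at this
    rw [this]
    group

theorem isVirtuallyLarge_mulAut_of_finiteIndex_mulAutConjStabilizer {W K : Type*} [Group W]
    [Group K] (f : W →* K) (hf : Function.Surjective f)
    (hcenter : ∀ p : K, (∀ q, p * q = q * p) → p = 1) (hK : IsVirtuallyLarge K)
    (hfin : (mulAutConjStabilizer f).FiniteIndex) : IsVirtuallyLarge (MulAut W) := by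
  choose p hp using fun φ : mulAutConjStabilizer f => φ.2
  have huniq : ∀ (φ : MulAut W) (q r : K), (∀ x, f (φ x) = q * f x * q⁻¹) →
      (∀ x, f (φ x) = r * f x * r⁻¹) → q = r := by
    intro φ q r hq hr
    have : r⁻¹ * q = 1 := by
      refine hcenter _ fun y => ?_
      obtain ⟨x, rfl⟩ := hf y
      have h := (hq x).symm.trans (hr x)
      calc r⁻¹ * q * f x = r⁻¹ * (q * f x * q⁻¹) * q := by group
        _ = f x * (r⁻¹ * q) := by rw [h]; group
    rw [← mul_one r, ← this]
    group
  refine hK.of_hom _ hfin (MonoidHom.mk' p fun φ ψ => ?_) ?_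
  · refine huniq (φ * ψ : MulAut W) _ _ (hp (φ * ψ)) fun x => ?_
    rw [MulAut.mul_apply, hp, hp]
    group
  · have : (MonoidHom.mk' p fun φ ψ => huniq (φ * ψ : MulAut W) _ _ (hp (φ * ψ)) fun x => by
        rw [MulAut.mul_apply, hp, hp]; group).range = ⊤ := by
      rw [MonoidHom.range_eq_top]
      intro y
      obtain ⟨w, rfl⟩ := hf y
      have hw : ∀ x, f (MulAut.conj w x) = f w * f x * (f w)⁻¹ := fun x => by simp
      exact ⟨⟨MulAut.conj w, f w, hw⟩, huniq _ _ _ (hp _) hw⟩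
    rw [this]
    infer_instance

/-- If `W` retracts onto a nontrivial free product of two finite groups, one of order at least
three, and the kernel contains the remaining torsion generators, then `MulAut W` is virtually
large. -/
theorem isVirtuallyLarge_mulAut_of_retraction {W : Type*} [Group W] {M : Bool → Type*}
    [∀ i, Group (M i)] [∀ i, Finite (M i)] {a : M false} (ha : a ≠ 1) {b c : M true} (hb : b ≠ 1)
    (hc : c ≠ 1) (hbc : b ≠ c) (ρ : W →* CoprodI M) (α : ∀ i, M i →* W)
    (hα : ∀ i m, ρ (α i m) = of m)
    (hgen : Subgroup.closure ((⋃ i, Set.range (α i)) ∪ {x | IsOfFinOrder x ∧ ρ x = 1}) = ⊤)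
    [Finite (W →* ∀ i, M i)] : IsVirtuallyLarge (MulAut W) := by
  have hM : ∀ i, Nontrivial (M i) := by
    rintro (_ | _)
    exacts [⟨⟨a, 1, ha⟩⟩, ⟨⟨b, 1, hb⟩⟩]
  have hρ : Function.Surjective ρ := by
    intro x
    induction x using CoprodI.induction_on with
    | one => exact ⟨1, map_one _⟩
    | of i m => exact ⟨α i m, hα i m⟩
    | mul x y hx hy =>
      obtain ⟨x', rfl⟩ := hx
      obtain ⟨y', rfl⟩ := hy
      exact ⟨x' * y', map_mul _ _ _⟩
  refine isVirtuallyLarge_mulAut_of_finiteIndex_mulAutConjStabilizer ρ hρ (fun p hp =>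
    eq_one_of_forall_commute_of p fun i m => hp _) (isVirtuallyLarge_coprodI ha hb hc hbc) ?_
  let A₁ := mulAutStabilizer ((coprodToPi M).comp ρ)
  have h₁ : A₁.FiniteIndex := finiteIndex_mulAutStabilizer _
  let θ : (∀ i, M i) → (CoprodI M →* CoprodI M) := fun c =>
    lift fun i => of.comp (MulAut.conj (c i)).toMonoidHom
  have hθ : ∀ c i (m : M i), θ c (of m) = of (c i) * of m * (of (c i))⁻¹ := by
    intro c i m
    simp [θ]
  have h₂ : (mulAutConjStabilizer ρ).relIndex A₁ ≠ 0 := by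
    refine relIndex_ne_zero_of_finite_invariant (X := ∀ i, M i) _ _
      (fun φ c => ∃ p, ∀ x, ρ (φ x) = p * θ c (ρ x) * p⁻¹) ?_ ?_
    · intro φ hφ
      have hφ' : ∀ x, coprodToPi M (ρ (φ x)) = coprodToPi M (ρ x) := hφ
      have h3 : ∀ i, ∃ g : CoprodI M, ∀ m : M i, ρ (φ (α i m)) = g * of m * g⁻¹ := fun i =>
        exists_conj_of_coprodToPi_comp ((ρ.comp φ.toMonoidHom).comp (α i)) fun m => by
          simp [hφ', hα]
      choose g hg using h3
      have hX : ∀ x, IsOfFinOrder x → ρ x = 1 → ρ (φ x) = 1 := fun x hx hx1 =>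
        eq_one_of_coprodToPi_eq_one 
          ((ρ.comp φ.toMonoidHom).isOfFinOrder hx) (by rw [hφ', hx1, map_one])
      have huniq : ∀ f₁ f₂ : W →* CoprodI M, (∀ i m, f₁ (α i m) = f₂ (α i m)) →
          (∀ x, IsOfFinOrder x → ρ x = 1 → f₁ x = f₂ x) → f₁ = f₂ := by
        intro f₁ f₂ h h'
        refine MonoidHom.eq_of_eqOn_dense hgen ?_
        rintro x (hx | hx)
        · obtain ⟨i, m, rfl⟩ := Set.mem_iUnion.mp hx
          exact h i m
        · exact h' x hx.1 hx.2
      let ψ : CoprodI M →* CoprodI M := lift fun i =>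
        (MulAut.conj ((g false)⁻¹ * g i)).toMonoidHom.comp of
      have hψ : ∀ i (m : M i), ψ (of m) =
          ((g false)⁻¹ * g i) * of m * ((g false)⁻¹ * g i)⁻¹ := by
        intro i m
        simp [ψ, mul_assoc]
      have h4 : ∀ x, ψ (ρ x) = (g false)⁻¹ * ρ (φ x) * ((g false)⁻¹)⁻¹ := by
        have := huniq (ψ.comp ρ)
          ((MulAut.conj (g false)⁻¹).toMonoidHom.comp (ρ.comp φ.toMonoidHom)) (fun i m => by
            simp only [MonoidHom.comp_apply, hα, hψ, MulEquiv.toMonoidHom_eq_coe,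
              MonoidHom.coe_coe, hg, MulAut.conj_apply]
            group) (fun x hx hx1 => by
            simp only [MonoidHom.comp_apply, hx1, map_one, MulEquiv.toMonoidHom_eq_coe,
              MonoidHom.coe_coe, hX x hx hx1])
        exact fun x => DFunLike.congr_fun this x
      have hψs : Function.Surjective ψ := by
        intro y
        obtain ⟨x, hx⟩ := hρ (g false * y * (g false)⁻¹)
        refine ⟨ρ (φ⁻¹ x), ?_⟩
        rw [h4, MulAut.apply_inv_self, hx]
        group
      obtain ⟨a', b', hab⟩ := exists_eq_of_mul_of_of_surjective ((g false)⁻¹ * g true) ψ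
        (fun m => by rw [hψ]; simp) (hψ true) hψs
      have hgt : g true = g false * of a' * of b' := by
        rw [mul_assoc, ← hab]; group
      let d : ∀ i, M i := fun i => match i with
        | false => a'⁻¹
        | true => b'
      refine ⟨d, g false * of a', fun x => ?_⟩
      have := huniq (ρ.comp φ.toMonoidHom)
        ((MulAut.conj (g false * of a')).toMonoidHom.comp ((θ d).comp ρ)) (fun i m => by
          simp only [MonoidHom.comp_apply, hα, hθ, MulEquiv.toMonoidHom_eq_coe,
              MonoidHom.coe_coe, hg, MulAut.conj_apply]
          rcases i with _ | _
          · simp only [d, map_inv]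
            group
          · simp only [d, hgt]
            group) (fun x hx hx1 => by
            simp only [MonoidHom.comp_apply, hx1, map_one, MulEquiv.toMonoidHom_eq_coe,
              MonoidHom.coe_coe, hX x hx hx1])
      exact DFunLike.congr_fun this x
    · rintro φ ψ d ⟨p, hp⟩ ⟨q, hq⟩
      refine ⟨p * q⁻¹, fun x => ?_⟩
      have h3 := hq (ψ⁻¹ x)
      rw [MulAut.apply_inv_self] at h3
      rw [MulAut.mul_apply, hp, h3]
      group
  rw [Subgroup.finiteIndex_iff, ← Subgroup.relIndex_top_right]
  refine Subgroup.relIndex_ne_zero_trans h₂ ?_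
  rw [Subgroup.relIndex_top_right]
  exact h₁.index_ne_zero

end Rigidity

section GraphProductBasics

namespace GraphProduct

variable {V : Type*} {Γ : SimpleGraph V} {G : V → Type*} [∀ w, Group (G w)]

theorem commute_of {u v : V} (h : Γ.Adj u v) (g : G u) (k : G v) :
    Commute (of Γ G u g) (of Γ G v k) := by
  have h1 : (QuotientGroup.mk' (Subgroup.normalClosure (graphProdRels Γ G)))
      (Monoid.CoprodI.of g * Monoid.CoprodI.of k *
      (Monoid.CoprodI.of g)⁻¹ * (Monoid.CoprodI.of k)⁻¹) = 1 :=
    (QuotientGroup.eq_one_iff _).mpr (Subgroup.subset_normalClosure ⟨u, v, h, g, k, rfl⟩)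
  rw [map_mul, map_mul, map_mul, map_inv, map_inv] at h1
  exact mul_inv_eq_iff_eq_mul.mp (mul_inv_eq_one.mp h1)

/-- The universal property of graph products. -/
def lift {K : Type*} [Group K] (f : ∀ u, G u →* K)
    (hf : ∀ u v, Γ.Adj u v → ∀ (g : G u) (k : G v), Commute (f u g) (f v k)) :
    GraphProduct Γ G →* K :=
  QuotientGroup.lift _ (Monoid.CoprodI.lift f) (by
    refine Subgroup.normalClosure_le_normal (N := (Monoid.CoprodI.lift f).ker) ?_
    rintro _ ⟨u, v, h, g, k, rfl⟩
    have := hf u v h g k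
    simp [MonoidHom.mem_ker, this.eq])

@[simp]
theorem lift_of {K : Type*} [Group K] (f : ∀ u, G u →* K)
    (hf : ∀ u v, Γ.Adj u v → ∀ (g : G u) (k : G v), Commute (f u g) (f v k)) (u : V) (g : G u) :
    lift f hf (of Γ G u g) = f u g := by
  change QuotientGroup.lift _ (Monoid.CoprodI.lift f) _ (QuotientGroup.mk' _ _) = _
  simp

theorem closure_range_of : Subgroup.closure (⋃ u, Set.range (of Γ G u)) = ⊤ := by
  rw [eq_top_iff]
  rintro ⟨x⟩ -
  change QuotientGroup.mk' (Subgroup.normalClosure (graphProdRels Γ G)) x ∈ _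
  induction x using Monoid.CoprodI.induction_on with
  | one => rw [map_one]; exact Subgroup.one_mem _
  | of i m => exact Subgroup.subset_closure (Set.mem_iUnion.mpr ⟨i, m, rfl⟩)
  | mul x y hx hy => rw [map_mul]; exact Subgroup.mul_mem _ hx hy

theorem hom_ext {K : Type*} [Group K] {f f' : GraphProduct Γ G →* K}
    (h : ∀ u g, f (of Γ G u g) = f' (of Γ G u g)) : f = f' := by
  refine MonoidHom.eq_of_eqOn_dense closure_range_of ?_
  intro x hx
  obtain ⟨u, g, rfl⟩ := Set.mem_iUnion.mp hx
  exact h u g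

theorem finite_hom [Finite V] [∀ w, Finite (G w)] {K : Type*} [Group K] [Finite K] :
    Finite (GraphProduct Γ G →* K) := by
  have : ∀ u, Finite (G u →* K) := fun u =>
    Finite.of_injective (fun f : G u →* K => (f : G u → K)) DFunLike.coe_injective
  refine Finite.of_injective (fun f : GraphProduct Γ G →* K => fun u => f.comp (of Γ G u)) ?_
  intro f f' h
  exact hom_ext fun u g => DFunLike.congr_fun (congrFun h u) g

open Monoid

theorem isVirtuallyLarge_mulAut_of_lift [Finite V] [∀ w, Finite (G w)] {M : Bool → Type*}
    [∀ i, Group (M i)] [∀ i, Finite (M i)] {a : M false} (ha : a ≠ 1) {b c : M true} (hb : b ≠ 1)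
    (hc : c ≠ 1) (hbc : b ≠ c) (ρ : GraphProduct Γ G →* CoprodI M)
    (α : ∀ i, M i →* GraphProduct Γ G) (hα : ∀ i m, ρ (α i m) = CoprodI.of m)
    (hgen : ∀ u g, (∃ i, of Γ G u g ∈ (α i).range) ∨ ρ (of Γ G u g) = 1) :
    IsVirtuallyLarge (GraphProduct Γ G) ∧ IsVirtuallyLarge (MulAut (GraphProduct Γ G)) := by
  constructor
  · refine (isVirtuallyLarge_coprodI ha hb hc hbc).of_surjective ρ fun x => ?_
    induction x using CoprodI.induction_on with
    | one => exact ⟨1, map_one _⟩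
    | of i m => exact ⟨α i m, hα i m⟩
    | mul x y hx hy =>
      obtain ⟨x', rfl⟩ := hx
      obtain ⟨y', rfl⟩ := hy
      exact ⟨x' * y', map_mul _ _ _⟩
  · have : Finite (GraphProduct Γ G →* ∀ i, M i) := finite_hom
    refine isVirtuallyLarge_mulAut_of_retraction ha hb hc hbc ρ α hα ?_
    rw [eq_top_iff, ← closure_range_of, Subgroup.closure_le]
    intro x hx
    obtain ⟨u, g, rfl⟩ := Set.mem_iUnion.mp hx
    refine Subgroup.subset_closure ?_
    rcases hgen u g with ⟨i, m, hm⟩ | h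
    · exact Or.inl (Set.mem_iUnion.mpr ⟨i, m, hm⟩)
    · exact Or.inr ⟨(of Γ G u).isOfFinOrder (isOfFinOrder_of_finite g), h⟩

/-- Two cliques without edges between them, of which the second one spans a group of order at
least three. -/
theorem isVirtuallyLarge_of_cliques [Finite V] [DecidableEq V] [∀ w, Finite (G w)]
    (S : Bool → Finset V) (hS : ∀ i, ∀ x ∈ S i, ∀ y ∈ S i, x ≠ y → Γ.Adj x y)
    (hSS : ∀ x ∈ S false, ∀ y ∈ S true, x ≠ y ∧ ¬ Γ.Adj x y) {a : ∀ x : S false, G x} (ha : a ≠ 1)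
    {b c : ∀ x : S true, G x} (hb : b ≠ 1) (hc : c ≠ 1) (hbc : b ≠ c) :
    IsVirtuallyLarge (GraphProduct Γ G) ∧ IsVirtuallyLarge (MulAut (GraphProduct Γ G)) := by
  let e : ∀ (i : Bool) (w : V), w ∈ S i → G w →* CoprodI fun i : Bool => ∀ x : S i, G x :=
    fun i w h => (CoprodI.of (M := fun i : Bool => ∀ x : S i, G x) (i := i)).comp
      (MonoidHom.mulSingle (fun x : S i => G x) ⟨w, h⟩)
  have he : ∀ i w w' h h' (g : G w) (g' : G w'), Γ.Adj w w' →
      Commute (e i w h g) (e i w' h' g') := by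
    intro i w w' h h' g g' hadj
    have h1 : (⟨w, h⟩ : S i) ≠ ⟨w', h'⟩ := fun h2 => hadj.ne (congrArg Subtype.val h2)
    exact (Pi.mulSingle_commute (f := fun x : S i => G x) h1 g g').map
      (CoprodI.of (M := fun i : Bool => ∀ x : S i, G x))
  let f : ∀ w, G w →* CoprodI fun i : Bool => ∀ x : S i, G x := fun w =>
    if h : w ∈ S false then e false w h else if h : w ∈ S true then e true w h else 1
  have hfe : ∀ i w h, f w = e i w h := by
    rintro (_ | _) w h
    · simp only [f, dif_pos h]
    · have h' : w ∉ S false := fun h' => (hSS w h' w h).1 rfl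
      simp only [f, dif_pos h, dif_neg h']
  have hf1 : ∀ w, w ∉ S false → w ∉ S true → f w = 1 := by
    intro w h h'
    simp only [f, dif_neg h, dif_neg h']
  have hf : ∀ x y, Γ.Adj x y → ∀ (g : G x) (k : G y), Commute (f x g) (f y k) := by
    intro x y hadj g k
    by_cases hx : x ∈ S false
    · by_cases hy : y ∈ S false
      · rw [hfe _ x hx, hfe _ y hy]
        exact he _ _ _ _ _ _ _ hadj
      · rw [hf1 y hy fun hy => (hSS x hx y hy).2 hadj]
        exact Commute.one_right _
    · by_cases hx' : x ∈ S true
      · by_cases hy : y ∈ S true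
        · rw [hfe _ x hx', hfe _ y hy]
          exact he _ _ _ _ _ _ _ hadj
        · rw [hf1 y (fun hy' => (hSS y hy' x hx').2 hadj.symm) hy]
          exact Commute.one_right _
      · rw [hf1 x hx hx']
        exact Commute.one_left _
  let α : ∀ i, (∀ x : S i, G x) →* GraphProduct Γ G := fun i =>
    MonoidHom.noncommPiCoprod (fun x : S i => of Γ G x) fun x y hxy g k =>
      commute_of (hS i x x.2 y y.2 fun h => hxy (Subtype.ext h)) g k
  have hα : ∀ i (w : S i) (g : G w), α i (Pi.mulSingle w g) = of Γ G w g := fun i w g =>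
    MonoidHom.noncommPiCoprod_mulSingle ..
  refine isVirtuallyLarge_mulAut_of_lift ha hb hc hbc (lift f hf) α (fun i m => ?_) fun w g => ?_
  · have : (lift f hf).comp (α i) =
        CoprodI.of (M := fun i : Bool => ∀ x : S i, G x) := by
      refine MonoidHom.pi_ext fun x g => ?_
      simp only [MonoidHom.comp_apply, hα, lift_of,
        hfe i x x.2]
      rfl
    exact DFunLike.congr_fun this m
  · by_cases hw : w ∈ S false
    · exact Or.inl ⟨false, _, hα false ⟨w, hw⟩ g⟩
    · by_cases hw' : w ∈ S true
      · exact Or.inl ⟨true, _, hα true ⟨w, hw'⟩ g⟩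
      · right
        rw [lift_of, hf1 w hw hw', MonoidHom.one_apply]

/-- Two nonadjacent vertices, one of whose groups has order at least three. -/
theorem isVirtuallyLarge_of_not_adj [Finite V] [∀ w, Finite (G w)] {u v : V} (huv : u ≠ v)
    (h : ¬ Γ.Adj u v) {a : G u} (ha : a ≠ 1) {b c : G v} (hb : b ≠ 1) (hc : c ≠ 1)
    (hbc : b ≠ c) :
    IsVirtuallyLarge (GraphProduct Γ G) ∧ IsVirtuallyLarge (MulAut (GraphProduct Γ G)) := by
  classical
  refine isVirtuallyLarge_of_cliques (fun i => {if i then v else u})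
    (fun i x hx y hy hxy => (hxy ?_).elim) (fun x hx y hy => ?_)
    (a := Pi.mulSingle ⟨u, by simp⟩ a) (by simpa using ha) (b := Pi.mulSingle ⟨v, by simp⟩ b)
    (c := Pi.mulSingle ⟨v, by simp⟩ c) (by simpa using hb) (by simpa using hc) (by simpa using hbc)
  · rw [Finset.mem_singleton.mp hx, Finset.mem_singleton.mp hy]
  · obtain rfl : x = u := by simpa using hx
    obtain rfl : y = v := by simpa using hy
    exact ⟨huv, h⟩

/-- A vertex which is not adjacent to two adjacent vertices. -/
theorem isVirtuallyLarge_of_not_adj_of_not_adj [Finite V] [∀ w, Finite (G w)]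
    [∀ w, Nontrivial (G w)] {u v w : V} (huv : u ≠ v) (huw : u ≠ w) (h : ¬ Γ.Adj u v)
    (h' : ¬ Γ.Adj u w) (hvw : Γ.Adj v w) :
    IsVirtuallyLarge (GraphProduct Γ G) ∧ IsVirtuallyLarge (MulAut (GraphProduct Γ G)) := by
  classical
  obtain ⟨a, ha⟩ := exists_ne (1 : G u)
  obtain ⟨b, hb⟩ := exists_ne (1 : G v)
  obtain ⟨c, hc⟩ := exists_ne (1 : G w)
  refine isVirtuallyLarge_of_cliques (fun i => if i then {v, w} else {u})
    (fun i x hx y hy hxy => ?_) (fun x hx y hy => ?_)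
    (a := Pi.mulSingle ⟨u, by simp⟩ a) (by simpa using ha) (b := Pi.mulSingle ⟨v, by simp⟩ b)
    (c := Pi.mulSingle ⟨w, by simp⟩ c) (by simpa using hb) (by simpa using hc) ?_
  · rcases i with _ | _
    · simp at hx hy
      exact (hxy (hx.trans hy.symm)).elim
    · simp at hx hy
      rcases hx with rfl | rfl <;> rcases hy with rfl | rfl
      exacts [(hxy rfl).elim, hvw, hvw.symm, (hxy rfl).elim]
  · obtain rfl : x = u := by simpa using hx
    simp at hy
    rcases hy with rfl | rfl
    exacts [⟨huv, h⟩, ⟨huw, h'⟩]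
  · intro heq
    have := congrFun heq ⟨v, by simp⟩
    rw [Pi.mulSingle_eq_same, Pi.mulSingle_eq_of_ne] at this
    · exact hb this
    · simpa using hvw.ne

end GraphProduct

end GraphProductBasics

section Sanov

open Matrix

/-- The generators of Sanov's subgroup of `GL₂(ℤ)`. -/
def sanovGen : Fin 2 → GL (Fin 2) ℤ :=
  ![⟨!![1, 2; 0, 1], !![1, -2; 0, 1], by simp [one_fin_two], by simp [one_fin_two]⟩,
    ⟨!![1, 0; 2, 1], !![1, 0; -2, 1], by simp [one_fin_two], by simp [one_fin_two]⟩]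

theorem coe_sanovGen_zero : (sanovGen 0 : Matrix (Fin 2) (Fin 2) ℤ) = !![1, 2; 0, 1] := rfl

theorem coe_sanovGen_one : (sanovGen 1 : Matrix (Fin 2) (Fin 2) ℤ) = !![1, 0; 2, 1] := rfl

theorem sanovGen_zero_mul (g : GL (Fin 2) ℤ) (i : Fin 2) :
    (sanovGen 0 * g) 0 i = g 0 i + 2 * g 1 i ∧ (sanovGen 0 * g) 1 i = g 1 i := by
  simp [coe_sanovGen_zero, Matrix.mul_apply]

theorem sanovGen_one_mul (g : GL (Fin 2) ℤ) (i : Fin 2) :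
    (sanovGen 1 * g) 0 i = g 0 i ∧ (sanovGen 1 * g) 1 i = g 1 i + 2 * g 0 i := by
  simp [coe_sanovGen_one, Matrix.mul_apply, add_comm]

theorem sanovGen_zero_inv_mul (g : GL (Fin 2) ℤ) (i : Fin 2) :
    ((sanovGen 0)⁻¹ * g) 0 i = g 0 i - 2 * g 1 i ∧ ((sanovGen 0)⁻¹ * g) 1 i = g 1 i := by
  obtain ⟨h0, h1⟩ := sanovGen_zero_mul ((sanovGen 0)⁻¹ * g) i
  rw [mul_inv_cancel_left] at h0 h1
  omega

theorem sanovGen_one_inv_mul (g : GL (Fin 2) ℤ) (i : Fin 2) :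
    ((sanovGen 1)⁻¹ * g) 0 i = g 0 i ∧ ((sanovGen 1)⁻¹ * g) 1 i = g 1 i - 2 * g 0 i := by
  obtain ⟨h0, h1⟩ := sanovGen_one_mul ((sanovGen 1)⁻¹ * g) i
  rw [mul_inv_cancel_left] at h0 h1
  omega

theorem GL_fin_two_col_ne_zero (g : GL (Fin 2) ℤ) : g 0 0 ≠ 0 ∨ g 1 0 ≠ 0 := by
  by_contra! h
  have h1 : (g⁻¹ * g) 0 0 = 1 := by simp
  rw [Units.val_mul, Matrix.mul_apply, Fin.sum_univ_two, h.1, h.2] at h1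
  simp at h1

open scoped Pointwise in
theorem injective_lift_sanovGen : Function.Injective (FreeGroup.lift sanovGen) := by
  let X : Fin 2 → Set (GL (Fin 2) ℤ) := ![{g | g 1 0 * g 1 0 ≤ g 0 0 * g 1 0},
    {g | g 0 0 * g 0 0 < g 0 0 * g 1 0 ∨ g 0 0 = 0}]
  let Y : Fin 2 → Set (GL (Fin 2) ℤ) := ![{g | g 0 0 * g 1 0 < -(g 1 0 * g 1 0)},
    {g | g 0 0 * g 1 0 ≤ -(g 0 0 * g 0 0) ∧ g 0 0 ≠ 0}]
  have hX0 : ∀ g ∈ X 0, g 1 0 * g 1 0 ≤ g 0 0 * g 1 0 := fun g h => h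
  have hX1 : ∀ g ∈ X 1, g 0 0 * g 0 0 < g 0 0 * g 1 0 ∨ g 0 0 = 0 := fun g h => h
  have hY0 : ∀ g ∈ Y 0, g 0 0 * g 1 0 < -(g 1 0 * g 1 0) := fun g h => h
  have hY1 : ∀ g ∈ Y 1, g 0 0 * g 1 0 ≤ -(g 0 0 * g 0 0) ∧ g 0 0 ≠ 0 := fun g h => h
  have hXd : Disjoint (X 0) (X 1) := by
    rw [Set.disjoint_left]
    intro g hg hg'
    have h := hX0 g hg
    rcases hX1 g hg' with h' | h'
    · nlinarith [sq_nonneg (g 0 0 - g 1 0)]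
    · rcases GL_fin_two_col_ne_zero g with h'' | h''
      · exact h'' h'
      · rw [h'] at h
        nlinarith [sq_pos_of_ne_zero h'']
  have hYd : Disjoint (Y 0) (Y 1) := by
    rw [Set.disjoint_left]
    intro g hg hg'
    have h := hY0 g hg
    have h' := (hY1 g hg').1
    nlinarith [sq_nonneg (g 0 0 + g 1 0)]
  refine FreeGroup.injective_lift_of_ping_pong sanovGen X Y ?_ ?_ ?_ ?_ ?_ ?_
  · intro i
    fin_cases i
    · exact ⟨1, by simp [X]⟩
    · exact ⟨⟨!![0, 1; 1, 0], !![0, 1; 1, 0], by simp [one_fin_two], by simp [one_fin_two]⟩,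
        Or.inr rfl⟩
  · intro i j hij
    fin_cases i <;> fin_cases j
    exacts [(hij rfl).elim, hXd, hXd.symm, (hij rfl).elim]
  · intro i j hij
    fin_cases i <;> fin_cases j
    exacts [(hij rfl).elim, hYd, hYd.symm, (hij rfl).elim]
  · intro i j
    rw [Set.disjoint_left]
    fin_cases i <;> fin_cases j <;> intro g hg hg'
    · have h := hX0 g hg
      have h' := hY0 g hg'
      nlinarith [sq_nonneg (g 1 0)]
    · have h := hX0 g hg
      obtain ⟨h', h0⟩ := hY1 g hg'
      nlinarith [sq_nonneg (g 1 0), sq_pos_of_ne_zero h0]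
    · have h' := hY0 g hg'
      rcases hX1 g hg with h | h
      · nlinarith [sq_nonneg (g 1 0), sq_nonneg (g 0 0)]
      · rw [h] at h'
        nlinarith [sq_nonneg (g 1 0)]
    · obtain ⟨h', h0⟩ := hY1 g hg'
      rcases hX1 g hg with h | h
      · nlinarith [sq_nonneg (g 0 0)]
      · exact h0 h
  · intro i
    rintro _ ⟨g, hg, rfl⟩
    fin_cases i
    · obtain ⟨h0, h1⟩ := sanovGen_zero_mul g 0
      have hg' : ¬ (g 0 0 * g 1 0 < -(g 1 0 * g 1 0)) := hg
      change (sanovGen 0 * g) 1 0 * (sanovGen 0 * g) 1 0 ≤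
        (sanovGen 0 * g) 0 0 * (sanovGen 0 * g) 1 0
      rw [h0, h1]
      nlinarith
    · obtain ⟨h0, h1⟩ := sanovGen_one_mul g 0
      have hg' : ¬ (g 0 0 * g 1 0 ≤ -(g 0 0 * g 0 0) ∧ g 0 0 ≠ 0) := hg
      change (sanovGen 1 * g) 0 0 * (sanovGen 1 * g) 0 0 <
        (sanovGen 1 * g) 0 0 * (sanovGen 1 * g) 1 0 ∨ (sanovGen 1 * g) 0 0 = 0
      rw [h0, h1]
      by_cases h : g 0 0 = 0
      · exact Or.inr h
      · left
        have : ¬ (g 0 0 * g 1 0 ≤ -(g 0 0 * g 0 0)) := fun h' => hg' ⟨h', h⟩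
        nlinarith
  · intro i
    rintro _ ⟨g, hg, rfl⟩
    fin_cases i
    · obtain ⟨h0, h1⟩ := sanovGen_zero_inv_mul g 0
      have hg' : ¬ (g 1 0 * g 1 0 ≤ g 0 0 * g 1 0) := hg
      change ((sanovGen 0)⁻¹ * g) 0 0 * ((sanovGen 0)⁻¹ * g) 1 0 <
        -(((sanovGen 0)⁻¹ * g) 1 0 * ((sanovGen 0)⁻¹ * g) 1 0)
      rw [h0, h1]
      nlinarith
    · obtain ⟨h0, h1⟩ := sanovGen_one_inv_mul g 0
      have hg' : ¬ (g 0 0 * g 0 0 < g 0 0 * g 1 0 ∨ g 0 0 = 0) := hg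
      push Not at hg'
      change ((sanovGen 1)⁻¹ * g) 0 0 * ((sanovGen 1)⁻¹ * g) 1 0 ≤
        -(((sanovGen 1)⁻¹ * g) 0 0 * ((sanovGen 1)⁻¹ * g) 0 0) ∧ ((sanovGen 1)⁻¹ * g) 0 0 ≠ 0
      rw [h0, h1]
      exact ⟨by nlinarith [hg'.1], hg'.2⟩

theorem mem_range_lift_sanovGen (n : ℕ) : ∀ g : GL (Fin 2) ℤ,
    (g 0 0).natAbs + (g 1 0).natAbs ≤ n → g 0 0 * g 1 1 - g 0 1 * g 1 0 = 1 → g 0 0 % 4 = 1 →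
      g 1 1 % 4 = 1 → g 0 1 % 2 = 0 → g 1 0 % 2 = 0 → g ∈ (FreeGroup.lift sanovGen).range := by
  have hgen : ∀ i, sanovGen i ∈ (FreeGroup.lift sanovGen).range := fun i =>
    ⟨FreeGroup.of i, by simp⟩
  induction n with
  | zero =>
    intro g hg
    rcases GL_fin_two_col_ne_zero g with h | h <;> omega
  | succ n ih =>
    intro g hn hdet h00 h11 h01 h10
    by_cases hr : g 1 0 = 0
    · have h1 : g 0 0 = 1 := by
        rw [hr, mul_zero, sub_zero] at hdet
        rcases Int.eq_one_or_neg_one_of_mul_eq_one hdet with h | h <;> omega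
      have h2 : g 1 1 = 1 := by rw [h1, hr] at hdet; omega
      obtain ⟨k, hk⟩ : ∃ k, g 0 1 = 2 * k := ⟨g 0 1 / 2, by omega⟩
      have hpow : ∀ m : ℕ, ((sanovGen 0 ^ m : GL (Fin 2) ℤ) : Matrix (Fin 2) (Fin 2) ℤ) =
          !![1, 2 * (m : ℤ); 0, 1] := by
        intro m
        induction m with
        | zero => simp [one_fin_two]
        | succ m ih => rw [pow_succ, Units.val_mul, ih, coe_sanovGen_zero]; simp; ring
      have hg : g = sanovGen 0 ^ k := by
        rcases Int.eq_nat_or_neg k with ⟨m, rfl | rfl⟩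
        · rw [zpow_natCast]
          refine Units.ext ?_
          rw [hpow, eta_fin_two g.val, h1, h2, hr, hk]
        · rw [_root_.zpow_neg, zpow_natCast, eq_inv_iff_mul_eq_one]
          refine Units.ext ?_
          rw [Units.val_mul, hpow, eta_fin_two g.val, h1, h2, hr, hk]
          simp [one_fin_two]
      rw [hg]
      exact Subgroup.zpow_mem _ (hgen 0) k
    · have hstep : ∃ i, ∃ e : GL (Fin 2) ℤ, (e = sanovGen i ∨ e = (sanovGen i)⁻¹) ∧
          ((e * g) 0 0).natAbs + ((e * g) 1 0).natAbs ≤ n ∧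
          ((i = 0 ∧ ∃ c : ℤ, (c = 2 ∨ c = -2) ∧ ∀ j, (e * g) 0 j = g 0 j + c * g 1 j ∧
              (e * g) 1 j = g 1 j) ∨
            (i = 1 ∧ ∃ c : ℤ, (c = 2 ∨ c = -2) ∧ ∀ j, (e * g) 0 j = g 0 j ∧
              (e * g) 1 j = g 1 j + c * g 0 j)) := by
        by_cases hlt : (g 1 0).natAbs < (g 0 0).natAbs
        · by_cases hs : (g 0 0 - 2 * g 1 0).natAbs < (g 0 0).natAbs
          · refine ⟨0, _, Or.inr rfl, ?_, Or.inl ⟨rfl, -2, Or.inr rfl, fun j => ?_⟩⟩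
            · have := sanovGen_zero_inv_mul g 0
              rw [this.1, this.2]
              omega
            · have := sanovGen_zero_inv_mul g j
              rw [this.1, this.2]
              omega
          · refine ⟨0, _, Or.inl rfl, ?_, Or.inl ⟨rfl, 2, Or.inl rfl, fun j => ?_⟩⟩
            · have := sanovGen_zero_mul g 0
              rw [this.1, this.2]
              omega
            · have := sanovGen_zero_mul g j
              rw [this.1, this.2]
              omega
        · by_cases hs : (g 1 0 - 2 * g 0 0).natAbs < (g 1 0).natAbs
          · refine ⟨1, _, Or.inr rfl, ?_, Or.inr ⟨rfl, -2, Or.inr rfl, fun j => ?_⟩⟩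
            · have := sanovGen_one_inv_mul g 0
              rw [this.1, this.2]
              omega
            · have := sanovGen_one_inv_mul g j
              rw [this.1, this.2]
              omega
          · refine ⟨1, _, Or.inl rfl, ?_, Or.inr ⟨rfl, 2, Or.inl rfl, fun j => ?_⟩⟩
            · have := sanovGen_one_mul g 0
              rw [this.1, this.2]
              omega
            · have := sanovGen_one_mul g j
              rw [this.1, this.2]
              omega
      obtain ⟨i, e, he, hle, hc⟩ := hstep
      have hmem : e * g ∈ (FreeGroup.lift sanovGen).range := by
        refine ih (e * g) hle ?_ ?_ ?_ ?_ ?_ <;>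
          rcases hc with ⟨-, c, hc, h⟩ | ⟨-, c, hc, h⟩ <;>
          simp only [(h 0).1, (h 0).2, (h 1).1, (h 1).2]
        · linear_combination hdet
        · linear_combination hdet
        all_goals rcases hc with rfl | rfl <;> omega
      have he' : e ∈ (FreeGroup.lift sanovGen).range := by
        rcases he with rfl | rfl
        exacts [hgen i, Subgroup.inv_mem _ (hgen i)]
      exact (Subgroup.mul_mem_cancel_left _ he').mp hmem

theorem relIndex_range_lift_sanovGen : (FreeGroup.lift sanovGen).range.relIndex ⊤ ≠ 0 := by
  let π := (Int.castRingHom (ZMod 4)).mapMatrix (m := Fin 2)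
  refine relIndex_ne_zero_of_finite_invariant _ _
    (fun (g : GL (Fin 2) ℤ) (x : Matrix (Fin 2) (Fin 2) (ZMod 4)) => π g = x)
    (fun g _ => ⟨_, rfl⟩) ?_
  rintro g g' _ rfl h
  set k := g * g'⁻¹ with hk
  have hk1 : π k = 1 := by
    rw [hk, Units.val_mul, map_mul, ← h, ← map_mul, ← Units.val_mul, mul_inv_cancel, Units.val_one,
      map_one]
  have hent : ∀ i j, ((k i j : ℤ) : ZMod 4) = (1 : Matrix (Fin 2) (Fin 2) (ZMod 4)) i j :=
    fun i j => congrFun (congrFun hk1 i) j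
  have h00 : k 0 0 % 4 = 1 :=
    (ZMod.intCast_eq_intCast_iff' _ 1 4).mp (by simpa using hent 0 0)
  have h11 : k 1 1 % 4 = 1 :=
    (ZMod.intCast_eq_intCast_iff' _ 1 4).mp (by simpa using hent 1 1)
  have h01 : k 0 1 % 4 = 0 :=
    (ZMod.intCast_eq_intCast_iff' _ 0 4).mp (by simpa using hent 0 1)
  have h10 : k 1 0 % 4 = 0 :=
    (ZMod.intCast_eq_intCast_iff' _ 0 4).mp (by simpa using hent 1 0)
  refine mem_range_lift_sanovGen _ k le_rfl ?_ h00 h11 (by omega) (by omega)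
  rw [← det_fin_two]
  have hdet : k.val.det % 4 = 1 := by
    rw [det_fin_two, Int.sub_emod, Int.mul_emod, h00, h11, Int.mul_emod (k 0 1), h01]
    norm_num
  rcases Int.isUnit_iff.mp ((Matrix.isUnit_iff_isUnit_det _).mp k.isUnit) with h | h <;> omega

/-- A group mapping to `GL₂(ℤ)` with image containing Sanov's subgroup is virtually large. -/
theorem isVirtuallyLarge_of_sanovGen_mem_range {G : Type*} [Group G] (f : G →* GL (Fin 2) ℤ)
    (hf : ∀ i, sanovGen i ∈ f.range) : IsVirtuallyLarge G := by
  let S := (FreeGroup.lift sanovGen).range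
  have hS : S ≤ f.range := by
    refine FreeGroup.range_lift_le ?_
    rintro _ ⟨i, rfl⟩
    exact hf i
  refine ⟨S.comap f, ?_, (MonoidHom.ofInjective injective_lift_sanovGen).symm.toMonoidHom.comp
    (f.subgroupComap S), ?_⟩
  · rw [Subgroup.finiteIndex_iff, Subgroup.index_comap]
    exact fun h => relIndex_range_lift_sanovGen (Subgroup.relIndex_eq_zero_of_le_right le_top h)
  · have : ((MonoidHom.ofInjective injective_lift_sanovGen).symm.toMonoidHom.comp
        (f.subgroupComap S)).range = ⊤ := by
      rw [MonoidHom.range_eq_top]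
      refine (MonoidHom.ofInjective injective_lift_sanovGen).symm.surjective.comp ?_
      rintro ⟨y, hy⟩
      obtain ⟨x, rfl⟩ := hS hy
      exact ⟨⟨x, hy⟩, rfl⟩
    rw [this]
    infer_instance

end Sanov

section TwistedCocycles

/-- A crossed homomorphism to `ℤ` twisted by the sign character `χ`. -/
def IsTwistedCocycle {W : Type*} [Group W] (χ : W →* ℤˣ) (t : W → ℤ) : Prop :=
  ∀ x y, t (x * y) = t x + χ x * t y

namespace IsTwistedCocycle

variable {W : Type*} [Group W] {χ : W →* ℤˣ} {t t' : W → ℤ}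

theorem map_one (ht : IsTwistedCocycle χ t) : t 1 = 0 := by
  simpa using ht 1 1

theorem map_inv (ht : IsTwistedCocycle χ t) (x : W) : t x⁻¹ = -(χ x * t x) := by
  have h := ht x⁻¹ x
  rw [inv_mul_cancel, ht.map_one, _root_.map_inv, Int.units_inv_eq_self] at h
  linarith

theorem eqOn_closure (ht : IsTwistedCocycle χ t) (ht' : IsTwistedCocycle χ t') {S : Set W}
    (h : ∀ x ∈ S, t x = t' x) : ∀ x ∈ Subgroup.closure S, t x = t' x := by
  intro x hx
  induction hx using Subgroup.closure_induction with
  | mem x hx => exact h x hx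
  | one => rw [ht.map_one, ht'.map_one]
  | mul x y _ _ hx hy => rw [ht, ht', hx, hy]
  | inv x _ hx => rw [ht.map_inv, ht'.map_inv, hx]

theorem map_pow (ht : IsTwistedCocycle χ t) {x : W} (hx : χ x = 1) (n : ℕ) :
    t (x ^ n) = n * t x := by
  induction n with
  | zero => simpa using ht.map_one
  | succ n ih =>
    rw [pow_succ, ht, ih, _root_.map_pow, hx]
    push_cast
    simp
    ring

theorem eq_zero_of_isOfFinOrder (ht : IsTwistedCocycle χ t) {x : W} (hx : χ x = 1)
    (hx' : IsOfFinOrder x) : t x = 0 := by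
  obtain ⟨n, hn, h⟩ := hx'.exists_pow_eq_one
  have := ht.map_pow hx n
  rw [h, ht.map_one] at this
  rcases mul_eq_zero.mp this.symm with h' | h'
  · exact absurd (Int.natCast_eq_zero.mp h') hn.ne'
  · exact h'

theorem comp (ht : IsTwistedCocycle χ t) {φ : MulAut W} (hφ : φ ∈ mulAutStabilizer χ) :
    IsTwistedCocycle χ fun x => t (φ x) := fun x y => by
  change t (φ (x * y)) = t (φ x) + χ x * t (φ y)
  rw [_root_.map_mul, ht, hφ]

theorem map_conj (ht : IsTwistedCocycle χ t) {k s : W} (hk : χ k = 1) (hs : χ s = -1) :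
    t (k * s * k⁻¹) = 2 * t k + t s := by
  rw [ht, ht, ht.map_inv, _root_.map_mul, hk, hs]
  push_cast
  ring

theorem add_mul_add_mul_add_const (ht : IsTwistedCocycle χ t) (ht' : IsTwistedCocycle χ t')
    (p q r : ℤ) : IsTwistedCocycle χ
      fun x => p * t x + q * t' x + (if χ x = 1 then 0 else r) := fun x y => by
  simp only [ht x y, ht' x y, _root_.map_mul]
  rcases Int.units_eq_one_or (χ x) with h | h <;> rcases Int.units_eq_one_or (χ y) with h' | h' <;>
    simp [h, h'] <;> ring

end IsTwistedCocycle

/-- Automorphisms preserving the sign character act on twisted cocycles modulo coboundaries. -/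
theorem isVirtuallyLarge_mulAut_of_cocycles {W : Type*} [Group W] (χ : W →* ℤˣ)
    [Finite (W →* ℤˣ)] (t : Fin 2 → W → ℤ) (ht : ∀ i, IsTwistedCocycle χ (t i)) (s : Fin 2 → W)
    (c : W) (hs : ∀ i, χ (s i) = -1) (hc : χ c = -1) (hts : ∀ i j, t i (s j) = if i = j then 1 else 0)
    (htc : ∀ i, t i c = 0) (hgen : Subgroup.closure
      ({x | (∃ i, x = s i) ∨ x = c ∨ (IsOfFinOrder x ∧ χ x = 1)}) = ⊤)
    (α : Fin 2 → MulAut W) (hα : ∀ i, α i ∈ mulAutStabilizer χ) (hαc : ∀ i, α i c = c)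
    (hα0 : α 0 (s 0) = s 0) (hα1 : α 1 (s 1) = s 1)
    (hα01 : α 0 (s 1) = (s 0 * c) * s 1 * (s 0 * c)⁻¹)
    (hα10 : α 1 (s 0) = (s 1 * c) * s 0 * (s 1 * c)⁻¹) :
    IsVirtuallyLarge (MulAut W) := by
  let M : mulAutStabilizer χ → Matrix (Fin 2) (Fin 2) ℤ := fun φ =>
    Matrix.of fun i j => t i (φ.1 (s j)) - t i (φ.1 c)
  have hM : ∀ φ i j, M φ i j = t i (φ.1 (s j)) - t i (φ.1 c) := fun φ i j => rfl
  have key : ∀ (φ : mulAutStabilizer χ) i x, t i (φ.1 x) =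
      M φ i 0 * t 0 x + M φ i 1 * t 1 x + (if χ x = 1 then 0 else t i (φ.1 c)) := by
    intro φ i x
    have h1 := (ht i).comp φ.2
    have h2 := (ht 0).add_mul_add_mul_add_const (ht 1) (M φ i 0) (M φ i 1) (t i (φ.1 c))
    refine h1.eqOn_closure h2 ?_ x (hgen ▸ Subgroup.mem_top x)
    rintro x (⟨j, rfl⟩ | rfl | ⟨hx, hx'⟩)
    · simp only [hts, hs, hM]
      fin_cases j <;> simp
    · simp [htc, hc]
    · rw [h1.eq_zero_of_isOfFinOrder hx' hx, h2.eq_zero_of_isOfFinOrder hx' hx]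
  have hone : M 1 = 1 := by
    ext i j
    simp [hM, hts, htc, Matrix.one_apply]
  have hmul : ∀ φ ψ, M (φ * ψ) = M φ * M ψ := by
    intro φ ψ
    ext i j
    rw [Matrix.mul_apply, Fin.sum_univ_two, hM, hM ψ, hM ψ]
    have h1 := key φ i (ψ.1 (s j))
    have h2 := key φ i (ψ.1 c)
    rw [ψ.2, hs] at h1
    rw [ψ.2, hc] at h2
    change t i (φ.1 (ψ.1 (s j))) - t i (φ.1 (ψ.1 c)) = _
    rw [h1, h2]
    ring
  let f : mulAutStabilizer χ →* GL (Fin 2) ℤ :=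
    MonoidHom.toHomUnits { toFun := M, map_one' := hone, map_mul' := hmul }
  have hf : ∀ i, f ⟨α i, hα i⟩ = sanovGen i := by
    have hχ : ∀ i, χ (s i * c) = 1 := fun i => by rw [map_mul, hs, hc]; rfl
    have htk : ∀ i j, t i (s j * c) = t i (s j) := fun i j => by rw [ht, htc]; simp
    intro i
    refine Units.ext ?_
    change M ⟨α i, hα i⟩ = _
    ext j k
    rw [hM]
    simp only [hαc, htc, sub_zero]
    fin_cases i
    · fin_cases k
      · simp only [Fin.zero_eta, hα0, hts]
        fin_cases j <;> simp [coe_sanovGen_zero]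
      · simp only [Fin.mk_one, Fin.zero_eta, hα01, (ht j).map_conj (hχ 0) (hs 1), htk, hts]
        fin_cases j <;> simp [coe_sanovGen_zero]
    · fin_cases k
      · simp only [Fin.mk_one, Fin.zero_eta, hα10, (ht j).map_conj (hχ 1) (hs 0), htk, hts]
        fin_cases j <;> simp [coe_sanovGen_one]
      · simp only [Fin.mk_one, hα1, hts]
        fin_cases j <;> simp [coe_sanovGen_one]
  refine (isVirtuallyLarge_of_sanovGen_mem_range f fun i => ⟨_, hf i⟩).of_hom _
    (finiteIndex_mulAutStabilizer χ) (MonoidHom.id _) ?_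
  rw [MonoidHom.range_eq_top.mpr Function.surjective_id]
  infer_instance

/-- The group of isometries of `ℤ`. -/
@[ext]
structure IntIsometry where
  /-- The linear part. -/
  sign : ℤˣ
  /-- The image of the origin. -/
  trans : ℤ

namespace IntIsometry

instance : Mul IntIsometry := ⟨fun x y => ⟨x.sign * y.sign, x.trans + x.sign * y.trans⟩⟩

instance : One IntIsometry := ⟨⟨1, 0⟩⟩

instance : Inv IntIsometry := ⟨fun x => ⟨x.sign, -(x.sign * x.trans)⟩⟩

@[simp] theorem sign_mul (x y : IntIsometry) : (x * y).sign = x.sign * y.sign := rfl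

@[simp] theorem trans_mul (x y : IntIsometry) : (x * y).trans = x.trans + x.sign * y.trans := rfl

@[simp] theorem sign_one : (1 : IntIsometry).sign = 1 := rfl

@[simp] theorem trans_one : (1 : IntIsometry).trans = 0 := rfl

instance : Group IntIsometry :=
  Group.ofLeftAxioms (fun x y z => by
      ext
      · simp [mul_assoc]
      · simp
        ring)
    (fun x => by ext <;> simp)
    (fun x => by
      ext
      · exact congrArg Units.val (Int.units_mul_self x.sign)
      · exact neg_add_cancel _)

/-- The linear part, as a homomorphism. -/
def signHom : IntIsometry →* ℤˣ where
  toFun := sign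
  map_one' := rfl
  map_mul' _ _ := rfl

@[simp] theorem signHom_apply (x : IntIsometry) : signHom x = x.sign := rfl

/-- The reflection exchanging `0` and `n`. -/
def reflection (n : ℤ) : IntIsometry := ⟨-1, n⟩

theorem reflection_mul_self (n : ℤ) : reflection n * reflection n = 1 := by
  ext <;> simp [reflection]

theorem isTwistedCocycle {W : Type*} [Group W] (f : W →* IntIsometry) :
    IsTwistedCocycle (signHom.comp f) fun x => (f x).trans := fun x y => by
  simp

end IntIsometry

end TwistedCocycles

section Reflections

open Classical in
/-- The homomorphism from a group of order two determined by an involution. -/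
noncomputable def homOfCardTwo {G K : Type*} [Group G] [Group K] (h : Nat.card G = 2) (d : K)
    (hd : d * d = 1) : G →* K where
  toFun g := if g = 1 then 1 else d
  map_one' := by simp
  map_mul' x y := by
    obtain ⟨z, hz, huniq⟩ := (Nat.card_eq_two_iff' (1 : G)).mp h
    by_cases hx : x = 1
    · simp [hx]
    by_cases hy : y = 1
    · simp [hy]
    have hxy : x * y = 1 := by
      by_contra hxy
      rw [huniq x hx] at hxy
      rw [huniq y hy] at hxy
      exact hz (mul_eq_left.mp (huniq _ hxy))
    simp [hx, hy, hxy, hd]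

theorem homOfCardTwo_of_ne_one {G K : Type*} [Group G] [Group K] (h : Nat.card G = 2) {d : K}
    (hd : d * d = 1) {g : G} (hg : g ≠ 1) : homOfCardTwo h d hd g = d := if_neg hg

namespace GraphProduct

variable {V : Type*} {Γ : SimpleGraph V} {G : V → Type*} [∀ w, Group (G w)]

open Classical in
/-- The homomorphism sending the nontrivial elements of the groups of order two at an independent
set of vertices to reflections of `ℤ`. -/
noncomputable def reflectionHom (T : Set V) (hT : ∀ u ∈ T, Nat.card (G u) = 2)
    (hΓ : ∀ u ∈ T, ∀ v ∈ T, ¬ Γ.Adj u v) (n : V → ℤ) : GraphProduct Γ G →* IntIsometry :=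
  lift (fun u => if h : u ∈ T then homOfCardTwo (hT u h) (IntIsometry.reflection (n u))
    (IntIsometry.reflection_mul_self _) else 1) (by
      intro u v huv g k
      by_cases hu : u ∈ T
      · by_cases hv : v ∈ T
        · exact absurd huv (hΓ u hu v hv)
        · rw [dif_neg hv]
          exact Commute.one_right _
      · rw [dif_neg hu]
        exact Commute.one_left _)

section reflectionHom

variable {T : Set V} {hT : ∀ u ∈ T, Nat.card (G u) = 2} {hΓ : ∀ u ∈ T, ∀ v ∈ T, ¬ Γ.Adj u v}
  {n : V → ℤ}

theorem reflectionHom_of_mem {u : V} (hu : u ∈ T) {g : G u} (hg : g ≠ 1) :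
    reflectionHom T hT hΓ n (of Γ G u g) = IntIsometry.reflection (n u) := by
  rw [reflectionHom, lift_of, dif_pos hu, homOfCardTwo_of_ne_one _ _ hg]

theorem reflectionHom_of_not_mem {u : V} (hu : u ∉ T) (g : G u) :
    reflectionHom T hT hΓ n (of Γ G u g) = 1 := by
  rw [reflectionHom, lift_of, dif_neg hu, MonoidHom.one_apply]

theorem signHom_comp_reflectionHom (m : V → ℤ) :
    IntIsometry.signHom.comp (reflectionHom T hT hΓ n) =
      IntIsometry.signHom.comp (reflectionHom T hT hΓ m) := by
  refine hom_ext fun u g => ?_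
  rw [MonoidHom.comp_apply, MonoidHom.comp_apply]
  by_cases hu : u ∈ T
  · by_cases hg : g = 1
    · rw [hg]
      simp
    · rw [reflectionHom_of_mem hu hg, reflectionHom_of_mem hu hg]
      rfl
  · rw [reflectionHom_of_not_mem hu, reflectionHom_of_not_mem hu]

end reflectionHom

open Classical in
/-- The endomorphism conjugating the vertex group at `v` by `k`. -/
noncomputable def partialConj (v : V) (k : GraphProduct Γ G)
    (hk : ∀ w, Γ.Adj v w → ∀ h : G w, Commute k (of Γ G w h)) :
    GraphProduct Γ G →* GraphProduct Γ G :=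
  lift (fun u => if u = v then (MulAut.conj k).toMonoidHom.comp (of Γ G u) else of Γ G u) (by
    have key : ∀ w, Γ.Adj v w → ∀ (g : G v) (h : G w),
        Commute (k * of Γ G v g * k⁻¹) (of Γ G w h) := fun w hw g h =>
      ((hk w hw h).mul_left (commute_of hw g h)).mul_left (hk w hw h).inv_left
    intro u w huw g h
    by_cases hu : u = v
    · subst hu
      rw [if_pos rfl, if_neg huw.ne']
      exact key w huw g h
    · by_cases hw : w = v
      · subst hw
        rw [if_pos rfl, if_neg hu]
        exact (key u huw.symm h g).symm
      · rw [if_neg hu, if_neg hw]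
        exact commute_of huw g h)

theorem partialConj_of_self {v : V} {k : GraphProduct Γ G}
    (hk : ∀ w, Γ.Adj v w → ∀ h : G w, Commute k (of Γ G w h)) (g : G v) :
    partialConj v k hk (of Γ G v g) = k * of Γ G v g * k⁻¹ := by
  rw [partialConj, lift_of, if_pos rfl]
  simp

theorem partialConj_of_ne {v : V} {k : GraphProduct Γ G}
    (hk : ∀ w, Γ.Adj v w → ∀ h : G w, Commute k (of Γ G w h)) {u : V} (hu : u ≠ v) (g : G u) :
    partialConj v k hk (of Γ G u g) = of Γ G u g := by
  rw [partialConj, lift_of, if_neg hu]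

theorem exists_partialConj {v x y : V} (hx : x ≠ v) (hy : y ≠ v)
    (hvx : ∀ w, Γ.Adj v w → Γ.Adj x w) (hvy : ∀ w, Γ.Adj v w → Γ.Adj y w) (g : G x) (h : G y) :
    ∃ α : MulAut (GraphProduct Γ G),
      (∀ k, α (of Γ G v k) =
        (of Γ G x g * of Γ G y h) * of Γ G v k * (of Γ G x g * of Γ G y h)⁻¹) ∧
      ∀ u, u ≠ v → ∀ k, α (of Γ G u k) = of Γ G u k := by
  have h1 : ∀ w, Γ.Adj v w → ∀ k : G w, Commute (of Γ G x g * of Γ G y h) (of Γ G w k) :=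
    fun w hw k => (commute_of (hvx w hw) g k).mul_left (commute_of (hvy w hw) h k)
  have h2 : ∀ w, Γ.Adj v w → ∀ k : G w, Commute (of Γ G x g * of Γ G y h)⁻¹ (of Γ G w k) :=
    fun w hw k => (h1 w hw k).inv_left
  have h3 : (partialConj v _ h1).comp (partialConj v _ h2) = MonoidHom.id _ := by
    refine hom_ext fun u k => ?_
    by_cases hu : u = v
    · subst hu
      rw [MonoidHom.comp_apply, partialConj_of_self]
      simp only [map_mul, map_inv, partialConj_of_self, partialConj_of_ne h1 hx,
        partialConj_of_ne h1 hy, MonoidHom.id_apply]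
      group
    · simp [partialConj_of_ne, hu]
  have h4 : (partialConj v _ h2).comp (partialConj v _ h1) = MonoidHom.id _ := by
    refine hom_ext fun u k => ?_
    by_cases hu : u = v
    · subst hu
      rw [MonoidHom.comp_apply, partialConj_of_self]
      simp only [map_mul, map_inv, partialConj_of_self, partialConj_of_ne h2 hx,
        partialConj_of_ne h2 hy, MonoidHom.id_apply]
      group
    · simp [partialConj_of_ne, hu]
  refine ⟨(partialConj v _ h1).toMulEquiv (partialConj v _ h2) h4 h3, fun k => ?_,
    fun u hu k => ?_⟩
  · exact partialConj_of_self h1 k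
  · exact partialConj_of_ne h1 hu k

/-- Three pairwise nonadjacent vertices with the same neighbors and groups of order two. -/
theorem isVirtuallyLarge_mulAut_of_three [Finite V] [∀ w, Finite (G w)] (s : Fin 2 → V) (c : V)
    (h01 : s 0 ≠ s 1) (hsc : ∀ i, s i ≠ c) (hs2 : ∀ i, Nat.card (G (s i)) = 2)
    (hc2 : Nat.card (G c) = 2) (hadj : ∀ i w, Γ.Adj (s i) w ↔ Γ.Adj c w) :
    IsVirtuallyLarge (MulAut (GraphProduct Γ G)) := by
  classical
  let T : Set V := {u | (∃ i, u = s i) ∨ u = c}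
  have hT : ∀ u ∈ T, Nat.card (G u) = 2 := by
    rintro u (⟨i, rfl⟩ | rfl)
    exacts [hs2 i, hc2]
  have hΓ' : ∀ u ∈ T, ∀ v, Γ.Adj u v ↔ Γ.Adj c v := by
    rintro u (⟨i, rfl⟩ | rfl) v
    exacts [hadj i v, Iff.rfl]
  have hΓ : ∀ u ∈ T, ∀ v ∈ T, ¬ Γ.Adj u v := by
    intro u hu v hv h
    have h1 := (hΓ' u hu v).mp h
    have h2 := (hΓ' v hv c).mp h1.symm
    exact h2.ne rfl
  have hne : ∀ i j, i ≠ j → s i ≠ s j := by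
    intro i j hij
    fin_cases i <;> fin_cases j
    exacts [(hij rfl).elim, h01, h01.symm, (hij rfl).elim]
  obtain ⟨c', hc', hcu⟩ := (Nat.card_eq_two_iff' (1 : G c)).mp hc2
  choose s' hs' hsu using fun i => (Nat.card_eq_two_iff' (1 : G (s i))).mp (hs2 i)
  have hsT : ∀ i, s i ∈ T := fun i => Or.inl ⟨i, rfl⟩
  have hcT : c ∈ T := Or.inr rfl
  have : Finite (GraphProduct Γ G →* ℤˣ) := finite_hom
  let χ := IntIsometry.signHom.comp (reflectionHom T hT hΓ 0)
  have hχ : ∀ u ∈ T, ∀ g : G u, g ≠ 1 → χ (of Γ G u g) = -1 := by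
    intro u hu g hg
    rw [MonoidHom.comp_apply, reflectionHom_of_mem hu hg]
    rfl
  have hχ' : ∀ u ∉ T, ∀ g : G u, χ (of Γ G u g) = 1 := by
    intro u hu g
    rw [MonoidHom.comp_apply, reflectionHom_of_not_mem hu, map_one]
  let R := fun i => reflectionHom T hT hΓ (Pi.single (s i) 1)
  have hstab : ∀ α : MulAut (GraphProduct Γ G), (∀ u, ∀ g : G u, ∃ k, α (of Γ G u g) =
      k * of Γ G u g * k⁻¹) → α ∈ mulAutStabilizer χ := by
    intro α hα x
    refine DFunLike.congr_fun (hom_ext (f := χ.comp α.toMonoidHom) (f' := χ) fun u g => ?_) x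
    obtain ⟨k, hk⟩ := hα u g
    rw [MonoidHom.comp_apply]
    change χ (α (of Γ G u g)) = _
    rw [hk, map_mul, map_mul, map_inv, mul_right_comm, mul_inv_cancel, one_mul]
  have hα : ∀ i j, i ≠ j → ∃ α : MulAut (GraphProduct Γ G),
      (∀ k, α (of Γ G (s j) k) = (of Γ G (s i) (s' i) * of Γ G c c') * of Γ G (s j) k *
        (of Γ G (s i) (s' i) * of Γ G c c')⁻¹) ∧
      ∀ u, u ≠ s j → ∀ k, α (of Γ G u k) = of Γ G u k := fun i j hij =>
    exists_partialConj (hne i j hij) (hsc j).symm (fun w h => (hadj i w).mpr ((hadj j w).mp h))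
      (fun w h => (hadj j w).mp h) _ _
  obtain ⟨α, hα1, hα2⟩ := hα 0 1 (by decide)
  obtain ⟨β, hβ1, hβ2⟩ := hα 1 0 (by decide)
  refine isVirtuallyLarge_mulAut_of_cocycles χ (fun i x => (R i x).trans) (fun i => ?_)
    (fun i => of Γ G (s i) (s' i)) (of Γ G c c') (fun i => hχ _ (hsT i) _ (hs' i))
    (hχ _ hcT _ hc') (fun i j => ?_) (fun i => ?_) ?_ ![α, β] ?_ ?_ ?_ ?_ ?_ ?_
  · have := IntIsometry.isTwistedCocycle (R i)
    rwa [signHom_comp_reflectionHom 0] at this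
  · simp only [R]
    rw [reflectionHom_of_mem (hsT j) (hs' j)]
    change (Pi.single (s i) 1 : V → ℤ) (s j) = _
    by_cases hij : i = j
    · subst hij
      simp
    · rw [Pi.single_eq_of_ne (hne i j hij).symm, if_neg hij]
  · simp only [R]
    rw [reflectionHom_of_mem hcT hc']
    exact Pi.single_eq_of_ne (hsc i).symm _
  · rw [eq_top_iff, ← closure_range_of, Subgroup.closure_le]
    intro x hx
    obtain ⟨u, g, rfl⟩ := Set.mem_iUnion.mp hx
    by_cases hg : g = 1
    · rw [hg, map_one]
      exact Subgroup.one_mem _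
    refine Subgroup.subset_closure ?_
    by_cases hu : u ∈ T
    · rcases hu with ⟨i, rfl⟩ | rfl
      · rw [hsu i g hg]
        exact Or.inl ⟨i, rfl⟩
      · rw [hcu g hg]
        exact Or.inr (Or.inl rfl)
    · exact Or.inr (Or.inr ⟨(of Γ G u).isOfFinOrder (isOfFinOrder_of_finite g), hχ' u hu g⟩)
  · have key : ∀ (j : Fin 2) (γ : MulAut (GraphProduct Γ G)) (k : GraphProduct Γ G),
        (∀ g, γ (of Γ G (s j) g) = k * of Γ G (s j) g * k⁻¹) →
        (∀ u, u ≠ s j → ∀ k, γ (of Γ G u k) = of Γ G u k) → γ ∈ mulAutStabilizer χ := by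
      intro j γ k h h'
      refine hstab γ fun u g => ?_
      by_cases hu : u = s j
      · subst hu
        exact ⟨k, h g⟩
      · exact ⟨1, by simp [h' u hu]⟩
    intro i
    fin_cases i
    exacts [key 1 α _ hα1 hα2, key 0 β _ hβ1 hβ2]
  · intro i
    fin_cases i
    exacts [hα2 _ (hsc 1).symm _, hβ2 _ (hsc 0).symm _]
  · exact hα2 _ h01 _
  · exact hβ2 _ h01.symm _
  · exact hα1 _
  · exact hβ1 _

end GraphProduct

end Reflections

section Dichotomy

namespace GraphProduct

/-- Every vertex has at most one non-neighbour, and vertices with a non-neighbour carry groups of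
order two. -/
def IsDihedralDecomposable {V : Type*} (Γ : SimpleGraph V) (G : V → Type*) : Prop :=
  ∀ u v, u ≠ v → ¬ Γ.Adj u v → Nat.card (G u) = 2 ∧ ∀ w, w ≠ u → ¬ Γ.Adj u w → w = v

variable {V : Type*} {Γ : SimpleGraph V} {G : V → Type*} [∀ w, Group (G w)]

theorem isVirtuallyLarge_of_independent [Finite V] [∀ w, Finite (G w)] [∀ w, Nontrivial (G w)]
    {a b c : V} (hab : a ≠ b) (hac : a ≠ c) (hbc : b ≠ c) (hb : ¬ Γ.Adj a b) (hc : ¬ Γ.Adj a c) :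
    IsVirtuallyLarge (GraphProduct Γ G) := by
  let Γ' := Γ ⊔ SimpleGraph.edge b c
  have hle : ∀ u v, Γ.Adj u v → Γ'.Adj u v := fun u v h => Or.inl h
  have hnot : ∀ w, ¬ Γ.Adj a w → ¬ Γ'.Adj a w := by
    intro w hw h
    rcases h with h | h
    · exact hw h
    · rw [SimpleGraph.edge_adj] at h
      grind
  have hbc' : Γ'.Adj b c := Or.inr ((SimpleGraph.edge_adj ..).mpr ⟨Or.inl ⟨rfl, rfl⟩, hbc⟩)
  refine (isVirtuallyLarge_of_not_adj_of_not_adj (Γ := Γ') (G := G) hab hac (hnot b hb)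
    (hnot c hc) hbc').1.of_surjective
    (lift (of Γ' G) fun u v h g k => commute_of (hle u v h) g k) ?_
  rw [← MonoidHom.range_eq_top, eq_top_iff, ← closure_range_of, Subgroup.closure_le]
  intro x hx
  obtain ⟨u, g, rfl⟩ := Set.mem_iUnion.mp hx
  exact ⟨of Γ G u g, lift_of _ _ u g⟩

theorem isVirtuallyLarge_of_card_ne_two [Finite V] [∀ w, Finite (G w)] [∀ w, Nontrivial (G w)]
    {u v : V} (huv : u ≠ v) (h : ¬ Γ.Adj u v) (hv : Nat.card (G v) ≠ 2) :
    IsVirtuallyLarge (GraphProduct Γ G) ∧ IsVirtuallyLarge (MulAut (GraphProduct Γ G)) := by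
  obtain ⟨a, ha⟩ := exists_ne (1 : G u)
  obtain ⟨b, hb⟩ := exists_ne (1 : G v)
  obtain ⟨c, hc, hcb⟩ : ∃ c : G v, c ≠ 1 ∧ c ≠ b := by
    by_contra! hcon
    exact hv ((Nat.card_eq_two_iff' (1 : G v)).mpr ⟨b, hb, hcon⟩)
  exact isVirtuallyLarge_of_not_adj huv h ha hb hc hcb.symm

theorem isVirtuallyLarge_of_not_isDihedralDecomposable [Finite V] [∀ w, Finite (G w)]
    [∀ w, Nontrivial (G w)] (h : ¬ IsDihedralDecomposable Γ G) :
    IsVirtuallyLarge (GraphProduct Γ G) ∧ IsVirtuallyLarge (MulAut (GraphProduct Γ G)) := by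
  by_cases h1 : ∃ u v, u ≠ v ∧ ¬ Γ.Adj u v ∧ Nat.card (G v) ≠ 2
  · obtain ⟨u, v, huv, hadj, hv⟩ := h1
    exact isVirtuallyLarge_of_card_ne_two huv hadj hv
  by_cases h2 : ∃ u v w, u ≠ v ∧ u ≠ w ∧ ¬ Γ.Adj u v ∧ ¬ Γ.Adj u w ∧ Γ.Adj v w
  · obtain ⟨u, v, w, huv, huw, h, h', hvw⟩ := h2
    exact isVirtuallyLarge_of_not_adj_of_not_adj huv huw h h' hvw
  push Not at h1 h2
  rw [IsDihedralDecomposable] at h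
  push Not at h
  obtain ⟨a, b, hab, hadj, h⟩ := h
  have hadj' : ¬ Γ.Adj b a := fun h => hadj h.symm
  obtain ⟨c, hca, hac, hcb⟩ := h (h1 b a hab.symm hadj')
  have hbc : ¬ Γ.Adj b c := h2 a b c hab hca.symm hadj hac
  have hlink : ∀ x y, x ≠ y → ¬ Γ.Adj x y → ∀ w, Γ.Adj x w → Γ.Adj y w := by
    intro x y hxy hadj w hw
    by_contra hyw
    have hyx : ¬ Γ.Adj y x := fun h => hadj h.symm
    refine h2 y x w hxy.symm ?_ hyx hyw hw
    rintro rfl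
    exact hadj hw
  have hlink' : ∀ x y, x ≠ y → ¬ Γ.Adj x y → ∀ w, Γ.Adj x w ↔ Γ.Adj y w := fun x y hxy hadj w =>
    ⟨hlink x y hxy hadj w, hlink y x hxy.symm (fun h => hadj h.symm) w⟩
  refine ⟨isVirtuallyLarge_of_independent hab hca.symm hcb.symm hadj hac, ?_⟩
  refine isVirtuallyLarge_mulAut_of_three ![a, b] c hab (Fin.forall_fin_two.mpr
    ⟨hca.symm, hcb.symm⟩) (Fin.forall_fin_two.mpr ⟨h1 b a hab.symm hadj', h1 a b hab hadj⟩)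
    (h1 a c hca.symm hac) (Fin.forall_fin_two.mpr ⟨hlink' a c hca.symm hac,
    hlink' b c hcb.symm hbc⟩)

end GraphProduct

/-- A group satisfying a law asserting that suitable powers commute is not SQ-universal. -/
theorem not_sqUniversal_of_commute_pow {G : Type*} [Group G] {m : ℕ} (hm : m ≠ 0)
    (h : ∀ x y : G, Commute (x ^ m) (y ^ m)) : ¬ SQUniversal G := by
  intro hG
  have : Countable (Matrix (Fin 2) (Fin 2) ℤ) := inferInstanceAs (Countable (Fin 2 → Fin 2 → ℤ))
  have : Countable (GL (Fin 2) ℤ) :=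
    Function.Injective.countable (f := fun g : GL (Fin 2) ℤ => (g : Matrix (Fin 2) (Fin 2) ℤ))
      Units.val_injective
  obtain ⟨N, hN, f, hf⟩ := hG (GL (Fin 2) ℤ)
  have key : Commute (sanovGen 0 ^ m) (sanovGen 1 ^ m) := by
    refine hf ?_
    rw [map_mul, map_mul, map_pow, map_pow]
    obtain ⟨x, hx⟩ := QuotientGroup.mk_surjective (f (sanovGen 0))
    obtain ⟨y, hy⟩ := QuotientGroup.mk_surjective (f (sanovGen 1))
    rw [← hx, ← hy]
    exact congrArg (QuotientGroup.mk' N) (h x y).eq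
  have h0 : ∀ n : ℕ, ((sanovGen 0 ^ n : GL (Fin 2) ℤ) : Matrix (Fin 2) (Fin 2) ℤ) =
      !![1, 2 * (n : ℤ); 0, 1] := by
    intro n
    induction n with
    | zero => simp [Matrix.one_fin_two]
    | succ n ih =>
      rw [pow_succ, Units.val_mul, ih, coe_sanovGen_zero, Matrix.mul_fin_two]
      push_cast
      ring_nf
  have h1 : ∀ n : ℕ, ((sanovGen 1 ^ n : GL (Fin 2) ℤ) : Matrix (Fin 2) (Fin 2) ℤ) =
      !![1, 0; 2 * (n : ℤ), 1] := by
    intro n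
    induction n with
    | zero => simp [Matrix.one_fin_two]
    | succ n ih =>
      rw [pow_succ, Units.val_mul, ih, coe_sanovGen_one, Matrix.mul_fin_two]
      push_cast
      ring_nf
  have h2 := congrArg (fun g : GL (Fin 2) ℤ => (g : Matrix (Fin 2) (Fin 2) ℤ) 0 0) key.eq
  simp only [Units.val_mul, h0, h1, Matrix.mul_fin_two] at h2
  simp at h2
  exact hm h2

theorem VirtuallyFreeAbelian.not_sqUniversal {G : Type*} [Group G] (h : VirtuallyFreeAbelian G) :
    ¬ SQUniversal G := by
  obtain ⟨H, hH, n, ⟨e⟩⟩ := h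
  refine not_sqUniversal_of_commute_pow (Nat.factorial_ne_zero H.index) fun x y => ?_
  have hmem : ∀ z : G, z ^ H.index.factorial ∈ H := fun z =>
    Subgroup.pow_mem_of_index_ne_zero_of_dvd hH.index_ne_zero z
      fun m hm hm' => Nat.dvd_factorial hm hm'
  have : (⟨_, hmem x⟩ : H) * ⟨_, hmem y⟩ = ⟨_, hmem y⟩ * ⟨_, hmem x⟩ :=
    e.injective (by rw [map_mul, map_mul, mul_comm])
  exact congrArg Subtype.val this

end Dichotomy

section VirtuallyAbelian

/-- An automorphism of a group preserving the kernel of a homomorphism to `ℤ` preserves the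
homomorphism up to sign. -/
theorem map_map_eq_of_map_eq_one_iff {A : Type*} [Group A] (t : A →* Multiplicative ℤ)
    (φ : A ≃* A) (h : ∀ x, t (φ x) = 1 ↔ t x = 1) (a : A) : t (φ (φ a)) = t a := by
  obtain ⟨a₀, ha₀⟩ : ∃ a₀ : A, ∀ a, ∃ n : ℤ, t a = t a₀ ^ n := by
    obtain ⟨⟨_, a₀, rfl⟩, hg⟩ := IsCyclic.exists_generator (α := t.range)
    refine ⟨a₀, fun a => ?_⟩
    obtain ⟨n, hn⟩ := Subgroup.mem_zpowers_iff.mp (hg ⟨t a, a, rfl⟩)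
    exact ⟨n, (congrArg Subtype.val hn).symm⟩
  have key : ∀ ψ : A ≃* A, (∀ a, t (ψ a) = 1 ↔ t a = 1) → ∃ e : ℤ, ∀ a, t (ψ a) = t a ^ e := by
    intro ψ hψ
    obtain ⟨e, he⟩ := ha₀ (ψ a₀)
    refine ⟨e, fun a => ?_⟩
    obtain ⟨n, hn⟩ := ha₀ a
    have h1 : t (ψ (a * (a₀ ^ n)⁻¹)) = 1 := by
      rw [hψ, map_mul, map_inv, map_zpow, hn, mul_inv_cancel]
    rw [map_mul, map_inv, map_zpow, map_mul, map_inv, map_zpow, he, mul_inv_eq_one] at h1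
    rw [h1, hn, ← zpow_mul, ← zpow_mul, mul_comm]
  obtain ⟨e, he⟩ := key φ h
  obtain ⟨e', he'⟩ := key φ.symm fun a => by rw [← h, φ.apply_symm_apply]
  rw [he, he, ← zpow_mul]
  by_cases ha : t a = 1
  · rw [ha, one_zpow]
  have h1 := he (φ.symm a)
  rw [he', φ.apply_symm_apply, ← zpow_mul] at h1
  have h2 : e' * e = 1 := by
    have h3 := congrArg Multiplicative.toAdd h1
    rw [toAdd_zpow, smul_eq_mul] at h3
    have h4 : Multiplicative.toAdd (t a) ≠ 0 := ha
    have h5 : (e' * e - 1) * Multiplicative.toAdd (t a) = 0 := by linarith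
    rcases mul_eq_zero.mp h5 with h6 | h6
    · linarith
    · exact absurd h6 h4
  have h3 : e * e = 1 := by
    rcases Int.eq_one_or_neg_one_of_mul_eq_one' h2 with ⟨-, h⟩ | ⟨-, h⟩ <;> simp [h]
  rw [h3, zpow_one]

/-- The intersection of the kernels of all homomorphisms to a given group. -/
def homKernel (W K : Type*) [Group W] [Group K] : Subgroup W := ⨅ f : W →* K, f.ker

theorem map_mem_homKernel {W K : Type*} [Group W] [Group K] (φ : MulAut W) {a : W}
    (ha : a ∈ homKernel W K) : φ a ∈ homKernel W K := by
  rw [homKernel, Subgroup.mem_iInf] at ha ⊢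
  exact fun f => ha (f.comp φ.toMonoidHom)

instance normal_homKernel {W K : Type*} [Group W] [Group K] : (homKernel W K).Normal :=
  ⟨fun _ ha g => map_mem_homKernel (MulAut.conj g) ha⟩

theorem finiteIndex_homKernel {W K : Type*} [Group W] [Group K] [Finite K] [Finite (W →* K)] :
    (homKernel W K).FiniteIndex :=
  Subgroup.finiteIndex_iInf fun f => Subgroup.finiteIndex_ker f

/-- Automorphisms acting trivially on an abelian subgroup and on its left cosets commute. -/
theorem MulAut.commute_of_fixes {W : Type*} [Group W] {A : Subgroup W}
    (hA : ∀ a ∈ A, ∀ b ∈ A, a * b = b * a) {φ ψ : MulAut W} (hφ : ∀ a ∈ A, φ a = a)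
    (hψ : ∀ a ∈ A, ψ a = a) (hφ' : ∀ w, w⁻¹ * φ w ∈ A) (hψ' : ∀ w, w⁻¹ * ψ w ∈ A) : Commute φ ψ := by
  refine MulEquiv.ext fun w => ?_
  have h1 : φ (ψ w) = φ w * (w⁻¹ * ψ w) := by
    conv_lhs => rw [← mul_inv_cancel_left w (ψ w)]
    rw [map_mul, hφ _ (hψ' w)]
  have h2 : ψ (φ w) = ψ w * (w⁻¹ * φ w) := by
    conv_lhs => rw [← mul_inv_cancel_left w (φ w)]
    rw [map_mul, hψ _ (hφ' w)]
  have h3 := hA _ (hφ' w) _ (hψ' w)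
  change φ (ψ w) = ψ (φ w)
  rw [h1, h2]
  calc φ w * (w⁻¹ * ψ w) = w * ((w⁻¹ * φ w) * (w⁻¹ * ψ w)) := by group
    _ = ψ w * (w⁻¹ * φ w) := by rw [h3]; group

/-- If `W` is virtually a subgroup of a product of infinite dihedral groups, compatibly with
reflections in the factors, then powers of automorphisms of `W` commute. -/
theorem exists_commute_pow_mulAut {W I : Type*} [Group W] (B : Subgroup W) [B.Normal]
    [B.FiniteIndex] (hfin : ∀ N : Subgroup W, ∀ [N.Normal] [N.FiniteIndex], Finite (W →* W ⧸ N))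
    (δ : I → W →* IntIsometry) (hδ : ∀ b ∈ B, (∀ i, (δ i b).trans = 0) → b = 1)
    (hsign : ∀ i, ∀ b ∈ B, (δ i b).sign = 1) (s : I → W) (hs : ∀ i, (δ i (s i)).sign = -1)
    (hs' : ∀ i j, i ≠ j → δ j (s i) = 1) :
    ∃ m : ℕ, m ≠ 0 ∧ ∀ x y : MulAut W, Commute (x ^ m) (y ^ m) := by
  have hinj : ∀ a ∈ B, ∀ b ∈ B, (∀ i, (δ i a).trans = (δ i b).trans) → a = b := by
    intro a ha b hb h
    refine mul_inv_eq_one.mp (hδ _ (B.mul_mem ha (B.inv_mem hb)) fun i => ?_)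
    have h1 := IntIsometry.trans_mul (δ i (a * b⁻¹)) (δ i b)
    rw [← map_mul, inv_mul_cancel_right, hsign i _ (B.mul_mem ha (B.inv_mem hb)), h] at h1
    simpa using h1
  have htrans : ∀ i, ∀ a ∈ B, ∀ b ∈ B, (δ i (a * b)).trans = (δ i a).trans + (δ i b).trans := by
    intro i a ha b hb
    rw [map_mul, IntIsometry.trans_mul, hsign i a ha]
    simp
  have hcomm : ∀ a ∈ B, ∀ b ∈ B, a * b = b * a := fun a ha b hb =>
    hinj _ (B.mul_mem ha hb) _ (B.mul_mem hb ha) fun i => by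
      rw [htrans i a ha b hb, htrans i b hb a ha, add_comm]
  have hcent : ∀ i, ∀ b ∈ B, (δ i b).trans = 0 ↔ s i * b * (s i)⁻¹ = b := by
    intro i b hb
    have hconj : s i * b * (s i)⁻¹ ∈ B := ‹B.Normal›.conj_mem b hb (s i)
    have h1 : (δ i (s i * b * (s i)⁻¹)).trans = -(δ i b).trans := by
      have h2 : s i * b = (s i * b * (s i)⁻¹) * s i := by group
      have h3 := congrArg (fun x => (δ i x).trans) h2
      simp only [map_mul _ (s i) b, map_mul _ _ (s i), IntIsometry.trans_mul, hs,
        hsign i _ hconj] at h3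
      push_cast at h3
      linarith
    constructor
    · intro h
      refine hinj _ hconj _ hb fun j => ?_
      by_cases hij : i = j
      · subst hij
        rw [h1, h, neg_zero]
      · rw [map_mul, map_mul, map_inv, hs' i j hij, one_mul, inv_one, mul_one]
    · intro h
      rw [h] at h1
      linarith
  have : Finite (W →* W ⧸ B) := hfin B
  let A := homKernel W (W ⧸ B)
  have : A.FiniteIndex := finiteIndex_homKernel
  have hAB : A ≤ B := by
    refine (iInf_le _ (QuotientGroup.mk' B)).trans ?_
    rw [QuotientGroup.ker_mk']
  have : Finite (W →* W ⧸ A) := hfin A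
  let D := mulAutStabilizer (QuotientGroup.mk' A)
  have hD : D.FiniteIndex := finiteIndex_mulAutStabilizer _
  have hDA : ∀ φ ∈ D, ∀ w, w⁻¹ * φ w ∈ A := fun φ hφ w =>
    QuotientGroup.eq.mp (hφ w).symm
  have hker : ∀ φ ∈ D, ∀ i, ∀ a ∈ A, (δ i a).trans = 0 → (δ i (φ a)).trans = 0 := by
    intro φ hφ i a ha h
    rw [hcent i a (hAB ha)] at h
    rw [hcent i _ (hAB (map_mem_homKernel φ ha))]
    have h1 := congrArg φ h
    rw [map_mul, map_mul, map_inv] at h1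
    have h2 := hDA φ hφ (s i)
    have h3 := hcomm _ (hAB h2) _ (hAB (map_mem_homKernel φ ha))
    rw [← mul_inv_eq_iff_eq_mul] at h3
    calc s i * φ a * (s i)⁻¹
        = s i * ((s i)⁻¹ * φ (s i) * φ a * ((s i)⁻¹ * φ (s i))⁻¹) * (s i)⁻¹ := by
          rw [h3]
      _ = φ (s i) * φ a * (φ (s i))⁻¹ := by group
      _ = φ a := h1
  have hsq : ∀ φ ∈ D, ∀ a ∈ A, (φ ^ 2) a = a := by
    intro φ hφ a ha
    refine hinj _ (hAB (map_mem_homKernel _ ha)) _ (hAB ha) fun i => ?_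
    let t : A →* Multiplicative ℤ :=
      { toFun := fun a => Multiplicative.ofAdd (δ i a).trans
        map_one' := by simp
        map_mul' := fun a b => by
          rw [Subgroup.coe_mul, htrans i _ (hAB a.2) _ (hAB b.2), ofAdd_add] }
    let φ' : A ≃* A :=
      { toFun := fun a => ⟨φ a, map_mem_homKernel φ a.2⟩
        invFun := fun a => ⟨φ⁻¹ a, map_mem_homKernel φ⁻¹ a.2⟩
        left_inv := fun a => Subtype.ext (φ.symm_apply_apply a)
        right_inv := fun a => Subtype.ext (φ.apply_symm_apply a)
        map_mul' := fun a b => Subtype.ext (map_mul φ _ _) }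
    refine map_map_eq_of_map_eq_one_iff t φ' (fun a => ⟨fun h => ?_, fun h => ?_⟩) ⟨a, ha⟩
    · have h1 := hker φ⁻¹ (D.inv_mem hφ) i _ (map_mem_homKernel φ a.2) h
      rwa [MulAut.inv_apply_self] at h1
    · exact hker φ hφ i a a.2 h
  have hpow : ∀ φ : MulAut W, φ ^ D.index.factorial ∈ D := fun φ =>
    Subgroup.pow_mem_of_index_ne_zero_of_dvd hD.index_ne_zero φ
      fun m hm hm' => Nat.dvd_factorial hm hm'
  refine ⟨D.index.factorial * 2, mul_ne_zero (Nat.factorial_ne_zero _) two_ne_zero,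
    fun x y => ?_⟩
  rw [pow_mul, pow_mul]
  exact MulAut.commute_of_fixes (A := A) (fun a ha b hb => hcomm a (hAB ha) b (hAB hb))
    (hsq _ (hpow x)) (hsq _ (hpow y)) (hDA _ (D.pow_mem (hpow x) 2)) (hDA _ (D.pow_mem (hpow y) 2))

end VirtuallyAbelian

theorem Subgroup.normal_closure_of_conj_mem {W : Type*} [Group W] {S T : Set W}
    (hT : Subgroup.closure T = ⊤) (hinv : ∀ g ∈ T, g⁻¹ ∈ T)
    (h : ∀ g ∈ T, ∀ x ∈ S, g * x * g⁻¹ ∈ Subgroup.closure S) : (Subgroup.closure S).Normal := by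
  have key : ∀ g ∈ T, ∀ x ∈ Subgroup.closure S, g * x * g⁻¹ ∈ Subgroup.closure S := by
    intro g hg x hx
    have : Subgroup.closure S ≤ (Subgroup.closure S).comap (MulAut.conj g).toMonoidHom :=
      (Subgroup.closure_le _).mpr fun y hy => h g hg y hy
    exact this hx
  suffices ∀ g ∈ Subgroup.closure T, ∀ x ∈ Subgroup.closure S,
      g * x * g⁻¹ ∈ Subgroup.closure S ∧ g⁻¹ * x * g ∈ Subgroup.closure S from
    ⟨fun x hx g => (this g (hT ▸ Subgroup.mem_top g) x hx).1⟩
  intro g hg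
  induction hg using Subgroup.closure_induction with
  | mem g hg => exact fun x hx => ⟨key g hg x hx, by simpa using key _ (hinv g hg) x hx⟩
  | one => simp
  | mul a b _ _ ha hb =>
    exact fun x hx => ⟨by simpa [mul_assoc] using (ha _ (hb x hx).1).1,
      by simpa [mul_assoc] using (hb _ (ha x hx).2).2⟩
  | inv a _ ha => exact fun x hx => ⟨by simpa using (ha x hx).2, by simpa using (ha x hx).1⟩

/-- The translations of `ℤ`. -/
def IntIsometry.translationHom : Multiplicative ℤ →* IntIsometry where
  toFun n := ⟨1, Multiplicative.toAdd n⟩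
  map_one' := rfl
  map_mul' x y := by ext <;> simp

/-- The homomorphism from a free abelian group determined by a commuting family. -/
theorem exists_monoidHom_of_commute {W I : Type*} [Group W] [Finite I] [DecidableEq I] (z : I → W)
    (hz : ∀ i j, i ≠ j → Commute (z i) (z j)) : ∃ f : (I → Multiplicative ℤ) →* W,
      (∀ j x, f (Pi.mulSingle j x) = zpowersHom W (z j) x) ∧
      f.range = Subgroup.closure (Set.range z) := by
  have := Fintype.ofFinite I
  have hcomm : Pairwise fun i j => ∀ x y, Commute (zpowersHom W (z i) x) (zpowersHom W (z j) y) :=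
    fun i j hij x y => (hz i j hij).zpow_zpow _ _
  refine ⟨MonoidHom.noncommPiCoprod _ hcomm, fun j x => ?_, ?_⟩
  · exact MonoidHom.noncommPiCoprod_mulSingle (ϕ := fun i => zpowersHom W (z i)) j x
  · rw [MonoidHom.noncommPiCoprod_range, ← Set.iUnion_singleton_eq_range, Subgroup.closure_iUnion]
    exact iSup_congr fun i => Subgroup.zpowers_eq_closure (z i)

namespace GraphProduct

variable {V : Type*} {Γ : SimpleGraph V} {G : V → Type*} [∀ w, Group (G w)]

/-- The non-edges of the graph, each taken with one of its two orientations. -/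
theorem IsDihedralDecomposable.exists_index {V : Type*} [Finite V] {Γ : SimpleGraph V}
    {G : V → Type*} (h : IsDihedralDecomposable Γ G) :
    ∃ (I : Type) (_ : Finite I) (p q : I → V), (∀ i, p i ≠ q i) ∧ (∀ i, ¬ Γ.Adj (p i) (q i)) ∧
      (∀ u v, u ≠ v → ¬ Γ.Adj u v → ∃ i, u = p i ∧ v = q i ∨ u = q i ∧ v = p i) ∧
      ∀ i j, i ≠ j → (p i ≠ p j ∧ p i ≠ q j) ∧ q i ≠ p j ∧ q i ≠ q j := by
  have e := Finite.equivFin V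
  refine ⟨{x : Fin (Nat.card V) × Fin (Nat.card V) //
    x.1 < x.2 ∧ ¬ Γ.Adj (e.symm x.1) (e.symm x.2)}, inferInstance, fun i => e.symm i.1.1,
    fun i => e.symm i.1.2, fun i hi => i.2.1.ne (e.symm.injective hi), fun i => i.2.2, ?_, ?_⟩
  · intro u v huv hadj
    rcases lt_trichotomy (e u) (e v) with hlt | heq | hlt
    · exact ⟨⟨(e u, e v), hlt, by simpa using hadj⟩, Or.inl (by simp)⟩
    · exact absurd (e.injective heq) huv
    · exact ⟨⟨(e v, e u), hlt, by simpa using fun h => hadj h.symm⟩, Or.inr (by simp)⟩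
  · have huniq : ∀ u v w, u ≠ v → ¬ Γ.Adj (e.symm u) (e.symm v) → u ≠ w →
        ¬ Γ.Adj (e.symm u) (e.symm w) → w = v := fun u v w huv h1 huw h2 =>
      e.symm.injective ((h _ _ (e.symm.injective.ne huv) h1).2 _ (e.symm.injective.ne huw.symm) h2)
    rintro ⟨⟨a, b⟩, hab, hadj⟩ ⟨⟨c, d⟩, hcd, hadj'⟩ hij
    simp only [ne_eq, Subtype.mk.injEq, Prod.mk.injEq] at hij
    simp only [ne_eq, EmbeddingLike.apply_eq_iff_eq]
    dsimp only at hab hcd hadj hadj'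
    have hba := fun h => hadj (SimpleGraph.Adj.symm h)
    have hdc := fun h => hadj' (SimpleGraph.Adj.symm h)
    refine ⟨⟨?_, ?_⟩, ?_, ?_⟩ <;> rintro rfl
    · exact hij ⟨rfl, huniq _ _ _ hcd.ne hadj' hab.ne hadj⟩
    · exact (hab.trans_eq (huniq _ _ _ hcd.ne' hdc hab.ne hadj)).not_gt hcd
    · exact hab.not_gt ((huniq _ _ _ hcd.ne hadj' hab.ne' hba) ▸ hcd)
    · exact hij ⟨huniq _ _ _ hcd.ne' hdc hab.ne' hba, rfl⟩

/-- Modulo a normal subgroup forcing the images of vertex groups to commute, a graph product of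
finite groups becomes finite. -/
theorem finiteIndex_of_commute [Finite V] [∀ w, Finite (G w)] (N : Subgroup (GraphProduct Γ G))
    [N.Normal] (h : ∀ u v, u ≠ v → ∀ x y, Commute (QuotientGroup.mk' N (of Γ G u x))
      (QuotientGroup.mk' N (of Γ G v y))) : N.FiniteIndex := by
  classical
  have := Fintype.ofFinite V
  have hcomm : Pairwise fun u v => ∀ (x : G u) (y : G v),
      Commute ((QuotientGroup.mk' N).comp (of Γ G u) x) ((QuotientGroup.mk' N).comp (of Γ G v) y) :=
    fun u v huv x y => h u v huv x y
  have hfinite : Finite (GraphProduct Γ G ⧸ N) := by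
    refine Finite.of_surjective (MonoidHom.noncommPiCoprod _ hcomm) ?_
    intro x
    obtain ⟨x, rfl⟩ := QuotientGroup.mk'_surjective _ x
    have hx : x ∈ Subgroup.closure (⋃ u, Set.range (of Γ G u)) :=
      closure_range_of (Γ := Γ) (G := G) ▸ Subgroup.mem_top x
    refine (Subgroup.closure_le (((MonoidHom.noncommPiCoprod _ hcomm).range).comap
      (QuotientGroup.mk' N))).mpr ?_ hx
    intro y hy
    obtain ⟨u, g, rfl⟩ := Set.mem_iUnion.mp hy
    exact ⟨Pi.mulSingle u g, MonoidHom.noncommPiCoprod_mulSingle _ u g⟩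
  exact Subgroup.finiteIndex_of_finite_quotient

theorem IsDihedralDecomposable.virtuallyFreeAbelian_and [Finite V] [∀ w, Finite (G w)]
    [∀ w, Nontrivial (G w)] (h : IsDihedralDecomposable Γ G) :
    VirtuallyFreeAbelian (GraphProduct Γ G) ∧
      ∃ m : ℕ, m ≠ 0 ∧ ∀ x y : MulAut (GraphProduct Γ G), Commute (x ^ m) (y ^ m) := by
  classical
  obtain ⟨I, _, p, q, hne, hadj, hpair, hI⟩ := h.exists_index
  have hadj' : ∀ i, ¬ Γ.Adj (q i) (p i) := fun i hi => hadj i hi.symm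
  have hcardp : ∀ i, Nat.card (G (p i)) = 2 := fun i => (h _ _ (hne i) (hadj i)).1
  have hcardq : ∀ i, Nat.card (G (q i)) = 2 := fun i => (h _ _ (hne i).symm (hadj' i)).1
  choose σ hσ using fun u => exists_ne (1 : G u)
  have hσ' : ∀ u, Nat.card (G u) = 2 → ∀ g : G u, g = 1 ∨ g = σ u := by
    intro u hu g
    obtain ⟨z, -, hz⟩ := (Nat.card_eq_two_iff' (1 : G u)).mp hu
    by_cases hg : g = 1
    · exact Or.inl hg
    · exact Or.inr ((hz g hg).trans (hz _ (hσ u)).symm)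
  obtain ⟨s, hs⟩ : ∃ s : V → GraphProduct Γ G, ∀ u, s u = of Γ G u (σ u) := ⟨_, fun _ => rfl⟩
  have hssq : ∀ u, Nat.card (G u) = 2 → s u * s u = 1 := by
    intro u hu
    rw [hs, ← map_mul]
    rcases hσ' u hu (σ u * σ u) with h | h
    · rw [h, map_one]
    · exact absurd (mul_eq_left.mp h) (hσ u)
  have hsp := fun i => hssq _ (hcardp i)
  have hsq := fun i => hssq _ (hcardq i)
  obtain ⟨z, hz⟩ : ∃ z : I → GraphProduct Γ G, ∀ i, z i = s (p i) * s (q i) := ⟨_, fun _ => rfl⟩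
  have hcomm : ∀ i w, w ≠ p i → w ≠ q i → ∀ k, Commute (of Γ G w k) (z i) := by
    intro i w hwp hwq k
    rw [hz, hs, hs]
    refine Commute.mul_right (commute_of ?_ _ _) (commute_of ?_ _ _)
    · by_contra hcon
      exact hwq ((h _ _ (hne i) (hadj i)).2 w hwp fun h => hcon h.symm)
    · by_contra hcon
      exact hwp ((h _ _ (hne i).symm (hadj' i)).2 w hwq fun h => hcon h.symm)
  obtain ⟨f, hfs, hf⟩ := exists_monoidHom_of_commute z fun i j hij => by
    rw [hz i, hs, hs]
    exact (hcomm j _ (hI i j hij).1.1 (hI i j hij).1.2 _).mul_left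
      (hcomm j _ (hI i j hij).2.1 (hI i j hij).2.2 _)
  have hzmem : ∀ i, z i ∈ f.range := fun i => hf ▸ Subgroup.subset_closure ⟨i, rfl⟩
  have hnormal : f.range.Normal := by
    rw [hf]
    refine Subgroup.normal_closure_of_conj_mem closure_range_of ?_ ?_
    · intro x hx
      obtain ⟨u, g, rfl⟩ := Set.mem_iUnion.mp hx
      exact Set.mem_iUnion.mpr ⟨u, g⁻¹, map_inv _ _⟩
    · rintro x hx _ ⟨i, rfl⟩
      obtain ⟨u, g, rfl⟩ := Set.mem_iUnion.mp hx
      rw [← hf]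
      by_cases hup : u = p i
      · subst hup
        rcases hσ' _ (hcardp i) g with rfl | rfl
        · simpa using hzmem i
        · convert f.range.inv_mem (hzmem i) using 1
          rw [← hs, eq_inv_iff_mul_eq_one, hz, ← mul_assoc, ← mul_assoc, hsp, one_mul,
            inv_mul_cancel_right, hsq]
      by_cases huq : u = q i
      · subst huq
        rcases hσ' _ (hcardq i) g with rfl | rfl
        · simpa using hzmem i
        · convert f.range.inv_mem (hzmem i) using 1
          rw [← hs, eq_inv_iff_mul_eq_one, hz, inv_eq_of_mul_eq_one_right (hsq i),
            mul_assoc (s (q i)), mul_assoc (s (p i)), hsq, mul_one, mul_assoc (s (q i)),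
            ← mul_assoc (s (p i)), hsp, one_mul, hsq]
      · rw [(hcomm i u hup huq g).eq, mul_inv_cancel_right]
        exact hzmem i
  have hindex : f.range.FiniteIndex := by
    have key : ∀ i, ∀ x y, Commute (QuotientGroup.mk' f.range (of Γ G (p i) x))
        (QuotientGroup.mk' f.range (of Γ G (q i) y)) := by
      intro i x y
      rcases hσ' _ (hcardp i) x with rfl | rfl
      · rw [map_one, map_one]
        exact Commute.one_left _
      rcases hσ' _ (hcardq i) y with rfl | rfl
      · rw [map_one, map_one]
        exact Commute.one_right _
      have h1 : QuotientGroup.mk' f.range (z i) = 1 := (QuotientGroup.eq_one_iff _).mpr (hzmem i)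
      rw [hz, map_mul] at h1
      rw [← hs, ← hs, eq_inv_of_mul_eq_one_left h1]
      exact (Commute.refl _).inv_left
    refine finiteIndex_of_commute _ fun u v huv x y => ?_
    by_cases huv' : Γ.Adj u v
    · exact (commute_of huv' x y).map (QuotientGroup.mk' f.range)
    obtain ⟨i, ⟨rfl, rfl⟩ | ⟨rfl, rfl⟩⟩ := hpair u v huv huv'
    · exact key i x y
    · exact (key i y x).symm
  obtain ⟨δ, hδp, hδq, hδ⟩ : ∃ δ : I → GraphProduct Γ G →* IntIsometry,
      (∀ i, δ i (s (p i)) = IntIsometry.reflection 1) ∧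
      (∀ i, δ i (s (q i)) = IntIsometry.reflection 0) ∧
      ∀ i u, u ≠ p i → u ≠ q i → δ i (s u) = 1 := by
    refine ⟨fun i => reflectionHom {p i, q i}
      (by rintro u (rfl | rfl); exacts [hcardp i, hcardq i])
      (by
        rintro u (rfl | rfl) v (rfl | rfl)
        exacts [Γ.irrefl, hadj i, hadj' i, Γ.irrefl]) (Pi.single (p i) 1), fun i => ?_,
      fun i => ?_, fun i u hp hq => ?_⟩
    · rw [hs, reflectionHom_of_mem (Set.mem_insert _ _) (hσ _), Pi.single_eq_same]
    · have hq : q i ∈ ({p i, q i} : Set V) := Set.mem_insert_of_mem _ rfl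
      rw [hs, reflectionHom_of_mem hq (hσ _), Pi.single_eq_of_ne (hne i).symm]
    · rw [hs]
      exact reflectionHom_of_not_mem (by rintro (h | h); exacts [hp h, hq h]) _
  have hδp' : ∀ i j, i ≠ j → δ j (s (p i)) = 1 := fun i j hij =>
    hδ _ _ (hI i j hij).1.1 (hI i j hij).1.2
  have hδq' : ∀ i j, i ≠ j → δ j (s (q i)) = 1 := fun i j hij =>
    hδ _ _ (hI i j hij).2.1 (hI i j hij).2.2
  have hδf : ∀ i n, δ i (f n) = IntIsometry.translationHom (n i) := by
    intro i n
    suffices (δ i).comp f = IntIsometry.translationHom.comp (Pi.evalMonoidHom _ i) from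
      DFunLike.congr_fun this n
    refine MonoidHom.pi_ext fun j x => ?_
    rw [MonoidHom.comp_apply, hfs]
    suffices (δ i).comp (zpowersHom _ (z j)) = (IntIsometry.translationHom.comp
        (Pi.evalMonoidHom _ i)).comp (MonoidHom.mulSingle (fun _ : I => Multiplicative ℤ) j) from
      DFunLike.congr_fun this x
    refine MonoidHom.ext_mint ?_
    simp only [MonoidHom.comp_apply, zpowersHom_apply, toAdd_ofAdd, zpow_one,
      MonoidHom.mulSingle_apply, Pi.evalMonoidHom_apply, hz, map_mul]
    by_cases hij : j = i
    · subst hij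
      rw [Pi.mulSingle_eq_same, hδp, hδq]
      rfl
    · rw [Pi.mulSingle_eq_of_ne' hij, hδp' _ _ hij, hδq' _ _ hij, map_one, one_mul]
  have hfinj : ∀ n, (∀ i, (δ i (f n)).trans = 0) → n = 1 := fun n hn => funext fun i => by
    have := hn i
    rw [hδf] at this
    exact this
  refine ⟨⟨f.range, hindex, Nat.card I, ⟨?_⟩⟩, ?_⟩
  · have hinj : Function.Injective f := (injective_iff_map_eq_one f).mpr fun n hn =>
      hfinj n fun i => by rw [hn, map_one, IntIsometry.trans_one]
    let ε := Finite.equivFin I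
    exact (MonoidHom.ofInjective hinj).symm.trans
      { toFun := fun n => Multiplicative.ofAdd fun k => Multiplicative.toAdd (n (ε.symm k))
        invFun := fun n i => Multiplicative.ofAdd (Multiplicative.toAdd n (ε i))
        left_inv := fun n => funext fun i => by simp
        right_inv := fun n => by simp
        map_mul' := fun n m => rfl }
  · refine exists_commute_pow_mulAut f.range (fun N _ _ => finite_hom) δ ?_ ?_
      (fun i => s (p i)) (fun i => by rw [hδp]; rfl) hδp'
    · rintro _ ⟨n, rfl⟩ hn
      rw [hfinj n hn, map_one]
    · rintro i _ ⟨n, rfl⟩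
      rw [hδf]
      rfl

end GraphProduct

/-- For a graph product of nontrivial finite groups, the automorphism group is SQ-universal
iff the graph product is not virtually free abelian. -/
theorem graphProduct_aut_sqUniversal_iff {V : Type} [Fintype V] (Γ : SimpleGraph V)
    (G : V → Type) [∀ w, Group (G w)] [∀ w, Finite (G w)] [∀ w, Nontrivial (G w)] :
    SQUniversal (MulAut (GraphProduct Γ G)) ↔ ¬VirtuallyFreeAbelian (GraphProduct Γ G) := by
  constructor
  · intro h hW
    have hΓ : GraphProduct.IsDihedralDecomposable Γ G := by
      by_contra hcon
      exact hW.not_sqUniversal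
        (GraphProduct.isVirtuallyLarge_of_not_isDihedralDecomposable hcon).1.sqUniversal
    obtain ⟨m, hm, hcomm⟩ := hΓ.virtuallyFreeAbelian_and.2
    exact not_sqUniversal_of_commute_pow hm hcomm h
  · intro h
    exact (GraphProduct.isVirtuallyLarge_of_not_isDihedralDecomposable fun hΓ =>
      h hΓ.virtuallyFreeAbelian_and.1).2.sqUniversal
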